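/- arXiv:math/0505116 — 7 statements merged into one kernel-verified Lean document; each statement's English description precedes it below -/
import Mathlib

section
/- Let K be a field, D a division K-algebra such that D ⊗_K D^o is a Noetherian ring, and σ₁, …, σ_t pairwise commuting K-algebra automorphisms of D. Then the set Ev(Δ) := { λ = (λ₁,…,λ_t) ∈ (K^×)^t : there exists u ∈ D, u ≠ 0, with σᵢ(u) = λᵢ·u for all i = 1,…,t } is a multiplicative subgroup of (K^×)^t and is a finitely generated abelian group. -/
open TensorProduct

namespace EvAux

open scoped Pointwise

/-- A family of subspaces behaving like the homogeneous components of a graded division ring. -/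
structure Gr {K D Λ : Type*} [Field K] [DivisionRing D] [Algebra K D] [CommGroup Λ]
    (V : Λ → Submodule K D) : Prop where
  indep : iSupIndep V
  one : (1 : D) ∈ V 1
  mul : ∀ {a b x y}, x ∈ V a → y ∈ V b → x * y ∈ V (a * b)
  inv : ∀ {a x}, x ∈ V a → x⁻¹ ∈ V a⁻¹

/-- Sum of the components indexed by `T`. -/
def E {K D Λ : Type*} [Field K] [DivisionRing D] [Algebra K D]
    (V : Λ → Submodule K D) (T : Set Λ) : Submodule K D := ⨆ g ∈ T, V g

section
variable {K D Λ : Type*} [Field K] [DivisionRing D] [Algebra K D] [CommGroup Λ]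
    {V : Λ → Submodule K D}

lemma V_le_E {T : Set Λ} {g : Λ} (hg : g ∈ T) : V g ≤ E V T :=
  le_iSup₂_of_le g hg le_rfl

lemma E_mono {S T : Set Λ} (h : S ⊆ T) : E V S ≤ E V T :=
  biSup_mono fun _ hi => h hi

lemma E_mul (hV : Gr V) {S T : Set Λ} {x y : D} (hx : x ∈ E V S) (hy : y ∈ E V T) :
    x * y ∈ E V (S * T) := by
  have : E V S * E V T ≤ E V (S * T) := by
    rw [E, E]
    simp only [Submodule.iSup_mul, Submodule.mul_iSup, iSup_le_iff, Submodule.mul_le]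
    intro i hi j hj m hm n hn
    first
      | exact V_le_E (V := V) (g := i * j) (Set.mul_mem_mul hi hj) (hV.mul hm hn)
      | exact V_le_E (V := V) (g := j * i) (Set.mul_mem_mul hj hi) (hV.mul hm hn)
  exact this (Submodule.mul_mem_mul hx hy)

lemma E_fin {T : Set Λ} {x : D} (hx : x ∈ E V T) :
    ∃ S : Finset Λ, (S : Set Λ) ⊆ T ∧ x ∈ E V (S : Set Λ) := by
  classical
  rw [E, iSup_subtype'] at hx
  obtain ⟨s, hs⟩ := Submodule.mem_iSup_iff_exists_finset.1 hx
  refine ⟨s.image Subtype.val, by simp, ?_⟩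
  have : (⨆ i ∈ s, V (i : Λ)) ≤ E V (↑(s.image Subtype.val) : Set Λ) := by
    refine iSup₂_le fun i hi => V_le_E ?_
    simpa using hi
  exact this hs

/-- the degree-one component -/
def D1 (hV : Gr V) : Subfield D where
  carrier := V 1
  mul_mem' := fun hx hy => by simpa using hV.mul hx hy
  one_mem' := hV.one
  add_mem' := fun hx hy => (V 1).add_mem hx hy
  zero_mem' := (V 1).zero_mem
  neg_mem' := fun hx => (V 1).neg_mem hx
  inv_mem' := fun x hx => by simpa using hV.inv hx

lemma sum_zero (hV : Gr V) {u : Λ → D} {B : Finset Λ} (hu : ∀ g ∈ B, u g ∈ V g ∧ u g ≠ 0)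
    (c : B → D1 hV) (h : ∑ g : B, (c g : D) * u g = 0) : ∀ g, c g = 0 := by
  classical
  have key := (iSupIndep_iff_finsetSum_eq_zero_imp_eq_zero V).1 hV.indep B
    (fun g => if hg : g ∈ B then (c ⟨g, hg⟩ : D) * u g else 0)
    (fun g hg => by
      have := hV.mul (c ⟨g, hg⟩).2 (hu g hg).1
      simpa [hg] using this)
    (by
      rw [← Finset.sum_coe_sort B]
      simpa using h)
  intro g
  have := key g g.2
  simp only [g.2, dite_true, Subtype.coe_eta, mul_eq_zero, (hu g g.2).2, or_false] at this
  exact_mod_cast this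

lemma E_le_span (hV : Gr V) {u : Λ → D} {B : Set Λ} (hu : ∀ g ∈ B, u g ∈ V g ∧ u g ≠ 0)
    {x : D} (hx : x ∈ E V B) : x ∈ Submodule.span (D1 hV) (u '' B) := by
  rw [E, iSup_subtype'] at hx
  refine Submodule.iSup_induction _ (motive := fun x => x ∈ Submodule.span (D1 hV) (u '' B)) hx
    ?_ (Submodule.zero_mem _) (fun x y hx hy => Submodule.add_mem _ hx hy)
  · intro i x hx
    have h1 : x * (u i)⁻¹ ∈ V 1 := by simpa using hV.mul hx (hV.inv (hu i i.2).1)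
    have : x = (⟨x * (u i)⁻¹, h1⟩ : D1 hV) • u i := by
      show x = x * (u i)⁻¹ * u i
      rw [mul_assoc, inv_mul_cancel₀ (hu i i.2).2, mul_one]
    rw [this]
    exact Submodule.smul_mem _ _ (Submodule.subset_span ⟨i, i.2, rfl⟩)

lemma count (hV : Gr V) {H : Subgroup Λ} {u : Λ → D} (hu : ∀ g ∈ H, u g ∈ V g ∧ u g ≠ 0)
    {a b : D} (S B B' : Finset Λ) (hB : ∀ g ∈ B, g ∈ H) (hB' : ∀ g ∈ B', g ∈ H)
    (hsub : (B : Set Λ) * (S : Set Λ) ⊆ B')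
    (ha : a ∈ E V (S : Set Λ)) (hb : b ∈ E V (S : Set Λ)) (ha0 : a ≠ 0) (hb0 : b ≠ 0)
    (hab : ∀ c ∈ E V (H : Set Λ), ∀ d ∈ E V (H : Set Λ), c * a = d * b → c = 0) :
    2 * B.card ≤ B'.card := by
  classical
  let v : B ⊕ B → D := Sum.elim (fun g => u g * a) (fun g => u g * b)
  have hmem : ∀ c : B → D1 hV, ∑ g : B, (c g : D) * u g ∈ E V (H : Set Λ) := by
    intro c
    refine Submodule.sum_mem _ fun g _ => V_le_E (hB g g.2) ?_
    simpa using hV.mul (c g).2 (hu g (hB g g.2)).1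
  have hli : LinearIndependent (D1 hV) v := by
    rw [Fintype.linearIndependent_iff]
    intro c hc
    rw [Fintype.sum_sum_type] at hc
    have e1 : (∑ g : B, (c (Sum.inl g) : D) * u g) * a + (∑ g : B, (c (Sum.inr g) : D) * u g) * b
        = 0 := by
      rw [← hc, Finset.sum_mul, Finset.sum_mul]
      congr 1 <;> refine Finset.sum_congr rfl fun g _ => ?_
      · exact mul_assoc _ _ _
      · exact mul_assoc _ _ _
    have z1 := hab _ (hmem fun g => c (Sum.inl g)) _ (Submodule.neg_mem _ (hmem fun g => c (Sum.inr g)))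
      (by rw [neg_mul]; exact eq_neg_of_add_eq_zero_left e1)
    have z2 : (∑ g : B, (c (Sum.inr g) : D) * u g) = 0 := by
      rw [z1, zero_mul, zero_add] at e1
      exact (mul_eq_zero.1 e1).resolve_right hb0
    have w1 := sum_zero hV (fun g hg => hu g (hB g hg)) (fun g => c (Sum.inl g)) z1
    have w2 := sum_zero hV (fun g hg => hu g (hB g hg)) (fun g => c (Sum.inr g)) z2
    rintro (g | g)
    · exact w1 g
    · exact w2 g
  have hle := linearIndependent_le_span' v hli (↑(B'.image u) : Set D) (by
    have aux : ∀ g : B, ∀ a ∈ E V (S : Set Λ), u g * a ∈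
        Submodule.span (D1 hV) (↑(B'.image u) : Set D) := by
      intro g a ha
      rw [Finset.coe_image]
      refine E_le_span hV (fun g hg => hu g (hB' g hg)) (E_mono hsub ?_)
      exact E_mul hV (V_le_E g.2 (hu g (hB g g.2)).1) ha
    rintro _ ⟨g | g, rfl⟩
    · exact aux g a ha
    · exact aux g b hb)
  simp only [Cardinal.mk_fintype, Fintype.card_sum, Fintype.card_coe, Nat.cast_le] at hle
  have : Fintype.card (↑(B'.image u) : Set D) ≤ B'.card := by
    simpa using Finset.card_image_le
  have hle2 : B.card + B.card ≤ Fintype.card (↑(B'.image u) : Set D) := by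
    exact_mod_cast hle
  omega

/-- box of products -/
noncomputable def box (S : Finset Λ) (n : ℕ) : Finset Λ := by
  classical
  exact Finset.univ.image (fun k : S → Fin (n + 1) => ∏ s : S, (s : Λ) ^ (k s : ℕ))

lemma box_card (S : Finset Λ) (n : ℕ) : (box S n).card ≤ (n + 1) ^ S.card := by
  classical
  refine Finset.card_image_le.trans ?_
  simp

lemma box_pos (S : Finset Λ) (n : ℕ) : 0 < (box S n).card := by
  classical
  rw [Finset.card_pos]
  exact Finset.univ_nonempty.image _

lemma box_mem (S : Finset Λ) (n : ℕ) (H : Subgroup Λ) (hS : ∀ g ∈ S, g ∈ H) :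
    ∀ g ∈ box S n, g ∈ H := by
  classical
  intro g hg
  obtain ⟨k, -, rfl⟩ := Finset.mem_image.1 hg
  exact Subgroup.prod_mem _ fun s _ => Subgroup.pow_mem _ (hS s s.2) _

lemma box_mul (S : Finset Λ) (n : ℕ) :
    (box S n : Set Λ) * (S : Set Λ) ⊆ box S (n + 1) := by
  classical
  rintro _ ⟨g, hg, s, hs, rfl⟩
  obtain ⟨k, -, rfl⟩ := Finset.mem_image.1 (Finset.mem_coe.1 hg)
  refine Finset.mem_coe.2 (Finset.mem_image.2
    ⟨fun r => ⟨(k r : ℕ) + if r = ⟨s, hs⟩ then 1 else 0, ?_⟩, Finset.mem_univ _, ?_⟩)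
  · have := (k r).2
    split_ifs <;> omega
  · simp only [pow_add, Finset.prod_mul_distrib]
    congr 1
    rw [Finset.prod_eq_single (⟨s, hs⟩ : S)]
    · simp
    · intro r _ hr
      simp [hr]
    · simp

lemma exists_pow_lt (k : ℕ) : ∃ n : ℕ, (n + 1) ^ k < 2 ^ n := by
  have h := tendsto_pow_const_div_const_pow_of_one_lt k (r := (2 : ℝ)) (by norm_num)
  have h2 := (h.eventually (gt_mem_nhds (show (0 : ℝ) < 1 / 2 by norm_num))).and
    (Filter.eventually_ge_atTop 1)
  obtain ⟨m, hm, hm1⟩ := h2.exists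
  obtain ⟨n, rfl⟩ : ∃ n, m = n + 1 := ⟨m - 1, by omega⟩
  refine ⟨n, ?_⟩
  rw [div_lt_iff₀ (by positivity), pow_succ (2 : ℝ)] at hm
  have : ((n + 1 : ℕ) : ℝ) ^ k < 2 ^ n := by linarith
  exact_mod_cast this

lemma ore (hV : Gr V) {H : Subgroup Λ} (hH : ∀ g ∈ H, ∃ u ∈ V g, u ≠ 0) {a b : D}
    (ha : a ∈ E V (H : Set Λ)) (hb : b ∈ E V (H : Set Λ)) (hb0 : b ≠ 0) :
    ∃ c ∈ E V (H : Set Λ), ∃ d ∈ E V (H : Set Λ), c ≠ 0 ∧ c * a = d * b := by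
  classical
  by_cases ha0 : a = 0
  · exact ⟨1, V_le_E H.one_mem hV.one, 0, Submodule.zero_mem _, one_ne_zero, by simp [ha0]⟩
  by_contra hcon
  have hab : ∀ c ∈ E V (H : Set Λ), ∀ d ∈ E V (H : Set Λ), c * a = d * b → c = 0 := by
    intro c hc d hd h
    by_contra hc0
    exact hcon ⟨c, hc, d, hd, hc0, h⟩
  choose! u hu using hH
  obtain ⟨S₁, hS₁, ha'⟩ := E_fin ha
  obtain ⟨S₂, hS₂, hb'⟩ := E_fin hb
  have hS : ∀ g ∈ S₁ ∪ S₂, g ∈ H := by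
    intro g hg
    rcases Finset.mem_union.1 hg with h | h
    · exact hS₁ h
    · exact hS₂ h
  have step : ∀ n, 2 * (box (S₁ ∪ S₂) n).card ≤ (box (S₁ ∪ S₂) (n + 1)).card := fun n =>
    count hV hu (S₁ ∪ S₂) _ _ (box_mem _ n H hS) (box_mem _ (n + 1) H hS) (box_mul _ n)
      (E_mono (by simp) ha') (E_mono (by simp) hb') ha0 hb0 hab
  have grow : ∀ n, 2 ^ n ≤ (box (S₁ ∪ S₂) n).card := by
    intro n
    induction n with
    | zero => simpa using box_pos (S₁ ∪ S₂) 0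
    | succ n ih =>
      rw [pow_succ]
      have := step n
      omega
  obtain ⟨n, hn⟩ := exists_pow_lt (S₁ ∪ S₂).card
  have h1 := grow n
  have h2 := box_card (S₁ ∪ S₂) n
  omega

lemma EH_mul (hV : Gr V) {H : Subgroup Λ} {x y : D} (hx : x ∈ E V (H : Set Λ))
    (hy : y ∈ E V (H : Set Λ)) : x * y ∈ E V (H : Set Λ) := by
  simpa using E_mul hV hx hy

/-- the division ring of left fractions -/
def frac (hV : Gr V) (H : Subgroup Λ) (hH : ∀ g ∈ H, ∃ u ∈ V g, u ≠ 0) : Subfield D where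
  carrier := {x | ∃ a ∈ E V (H : Set Λ), a ≠ 0 ∧ a * x ∈ E V (H : Set Λ)}
  one_mem' := ⟨1, V_le_E H.one_mem hV.one, one_ne_zero, by
    simpa using V_le_E (V := V) (T := (H : Set Λ)) H.one_mem hV.one⟩
  zero_mem' := ⟨1, V_le_E H.one_mem hV.one, one_ne_zero, by simp⟩
  neg_mem' := by
    rintro x ⟨a, ha, ha0, h⟩
    exact ⟨a, ha, ha0, by simpa using h⟩
  add_mem' := by
    rintro x y ⟨a, ha, ha0, hx⟩ ⟨b, hb, hb0, hy⟩
    obtain ⟨c, hc, d, hd, hc0, h⟩ := ore hV hH ha hb hb0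
    refine ⟨c * a, EH_mul hV hc ha, mul_ne_zero hc0 ha0, ?_⟩
    rw [mul_add]
    refine Submodule.add_mem _ ?_ ?_
    · rw [mul_assoc]
      exact EH_mul hV hc hx
    · rw [h, mul_assoc]
      exact EH_mul hV hd hy
  mul_mem' := by
    rintro x y ⟨a, ha, ha0, hx⟩ ⟨b, hb, hb0, hy⟩
    obtain ⟨c, hc, d, hd, hc0, h⟩ := ore hV hH hx hb hb0
    refine ⟨c * a, EH_mul hV hc ha, mul_ne_zero hc0 ha0, ?_⟩
    have : c * a * (x * y) = d * (b * y) := by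
      rw [← mul_assoc d, ← h]
      simp only [mul_assoc]
    rw [this]
    exact EH_mul hV hd hy
  inv_mem' := by
    rintro x ⟨a, ha, ha0, hx⟩
    by_cases hx0 : x = 0
    · exact ⟨a, ha, ha0, by simp [hx0]⟩
    · exact ⟨a * x, hx, mul_ne_zero ha0 hx0, by rwa [mul_assoc, mul_inv_cancel₀ hx0, mul_one]⟩

lemma E_le_frac (hV : Gr V) (H : Subgroup Λ) (hH : ∀ g ∈ H, ∃ u ∈ V g, u ≠ 0) {x : D}
    (hx : x ∈ E V (H : Set Λ)) : x ∈ frac hV H hH :=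
  ⟨1, V_le_E H.one_mem hV.one, one_ne_zero, by simpa using hx⟩

lemma notMem_frac (hV : Gr V) (H : Subgroup Λ) (hH : ∀ g ∈ H, ∃ u ∈ V g, u ≠ 0) {g : Λ}
    (hg : g ∉ H) {u : D} (hu : u ∈ V g) (hu0 : u ≠ 0) : u ∉ frac hV H hH := by
  rintro ⟨a, ha, ha0, h⟩
  have h1 : a * u ∈ E V ((H : Set Λ) * {g}) := by
    have hu' : u ∈ E V ({g} : Set Λ) := V_le_E (V := V) (g := g) (Set.mem_singleton g) hu
    exact E_mul hV ha hu'
  have hd : Disjoint (H : Set Λ) ((H : Set Λ) * {g}) := by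
    rw [Set.disjoint_left]
    rintro _ hx ⟨y, hy, _, rfl, rfl⟩
    exact hg ((H.mul_mem_cancel_left hy).1 hx)
  have := Submodule.disjoint_def.1 (hV.indep.disjoint_biSup_biSup hd) _ h h1
  exact mul_ne_zero ha0 hu0 this

/-- The commutator-type element. -/
def cm (K : Type*) {D : Type*} [Field K] [DivisionRing D] [Algebra K D] (u : D) :
    D ⊗[K] Dᵐᵒᵖ := u ⊗ₜ 1 - 1 ⊗ₜ MulOpposite.op u

lemma notMem_span (hV : Gr V) (H : Subgroup Λ) (hH : ∀ g ∈ H, ∃ u ∈ V g, u ≠ 0) {g : Λ}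
    (hg : g ∉ H) {u : D} (hu : u ∈ V g) (hu0 : u ≠ 0) (s : Set (D ⊗[K] Dᵐᵒᵖ))
    (hs : ∀ z ∈ s, ∃ h ∈ H, ∃ w ∈ V h, z = cm K w) : cm K u ∉ Ideal.span s := by
  have hL := notMem_frac hV H hH hg hu hu0
  have hnot : u ∉ Submodule.span (frac hV H hH) {(1 : D)} := by
    rw [Submodule.mem_span_singleton]
    rintro ⟨c, rfl⟩
    apply hL
    show (c : D) * 1 ∈ _
    simp
  obtain ⟨f, hfu, hf1⟩ := Submodule.exists_le_ker_of_notMem hnot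
  have hf1 : f 1 = 0 := hf1 (Submodule.mem_span_singleton_self _)
  have hflin : ∀ w ∈ E V (H : Set Λ), ∀ x, (f (w * x) : D) = w * (f x : D) := by
    intro w hw x
    have := f.map_smul ⟨w, E_le_frac hV H hH hw⟩ x
    exact congrArg Subtype.val this
  have hK : ∀ (c : K) (x : D), (f (c • x) : D) = c • (f x : D) := by
    intro c x
    have hc : c • (1 : D) ∈ E V (H : Set Λ) :=
      V_le_E H.one_mem ((V 1).smul_mem c hV.one)
    simpa using hflin _ hc x
  let ψ : D ⊗[K] Dᵐᵒᵖ →ₗ[K] D := TensorProduct.lift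
    (LinearMap.mk₂ K (fun (a : D) (b : Dᵐᵒᵖ) => a * (f b.unop : D))
      (fun a a' b => add_mul _ _ _) (fun c a b => by simp)
      (fun a b b' => by simp [mul_add]) (fun c a b => by simp [hK]))
  have hψ : ∀ a b, ψ (a ⊗ₜ b) = a * (f b.unop : D) := fun a b => rfl
  have hkill : ∀ z ∈ Ideal.span s, ∀ r, ψ (r * z) = 0 := by
    intro z hz
    induction hz using Submodule.span_induction with
    | mem z hz =>
      obtain ⟨h, hh, w, hw, rfl⟩ := hs z hz
      intro r
      induction r with
      | zero => simp
      | add r r' h1 h2 => rw [add_mul, map_add, h1, h2, add_zero]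
      | tmul a b =>
        rw [cm, mul_sub, map_sub, Algebra.TensorProduct.tmul_mul_tmul,
          Algebra.TensorProduct.tmul_mul_tmul, hψ, hψ]
        simp [hflin w (V_le_E hh hw), mul_assoc]
    | zero => simp
    | add x y _ _ hx hy =>
      intro r
      rw [mul_add, map_add, hx, hy, add_zero]
    | smul c x _ hx =>
      intro r
      rw [smul_eq_mul, ← mul_assoc]
      exact hx _
  intro hmem
  have := hkill _ hmem 1
  rw [one_mul, cm, map_sub, hψ, hψ] at this
  apply hfu
  simpa [hf1] using this

lemma fg (hV : Gr V) (hN : IsNoetherianRing (D ⊗[K] Dᵐᵒᵖ)) (G : Subgroup Λ)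
    (hG : ∀ g, g ∈ G ↔ ∃ u ∈ V g, u ≠ 0) : G.FG := by
  classical
  let s : Set (D ⊗[K] Dᵐᵒᵖ) := {z | ∃ h ∈ G, ∃ w ∈ V h, z = cm K w}
  obtain ⟨s', hs', hspan⟩ := (Submodule.fg_span_iff_fg_span_finset_subset
    (R := D ⊗[K] Dᵐᵒᵖ) s).1 (IsNoetherian.noetherian _)
  have hs'' : ∀ z ∈ s', ∃ h, h ∈ G ∧ ∃ w, w ∈ V h ∧ z = cm K w := fun z hz => by
    obtain ⟨h, hh, w, hw, e⟩ := hs' hz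
    exact ⟨h, hh, w, hw, e⟩
  choose! φ hφG w hw hz using hs''
  let T : Finset Λ := s'.image φ
  have hTG : Subgroup.closure (T : Set Λ) ≤ G := by
    rw [Subgroup.closure_le]
    intro x hx
    obtain ⟨z, hz, rfl⟩ := Finset.mem_image.1 (Finset.mem_coe.1 hx)
    exact hφG _ hz
  refine ⟨T, le_antisymm hTG ?_⟩
  intro g hg
  by_contra hgT
  obtain ⟨u, hu, hu0⟩ := (hG g).1 hg
  refine notMem_span hV (Subgroup.closure (T : Set Λ)) (fun g hg => (hG g).1 (hTG hg)) hgT hu hu0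
    (s' : Set _) ?_ ?_
  · intro z hz'
    exact ⟨φ z, Subgroup.subset_closure (Finset.mem_coe.2 (Finset.mem_image_of_mem φ hz')),
      w z, hw z hz', hz z hz'⟩
  · have : cm K u ∈ Submodule.span (D ⊗[K] Dᵐᵒᵖ) s := Submodule.subset_span ⟨g, hg, u, hu, rfl⟩
    rw [hspan] at this
    exact this

end

/-- simultaneous eigenspaces -/
def W {K D : Type*} [Field K] [DivisionRing D] [Algebra K D] {t : ℕ}
    (σ : Fin t → (D ≃ₐ[K] D)) (lam : Fin t → Kˣ) : Submodule K D where
  carrier := {u | ∀ i, σ i u = (lam i : K) • u}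
  add_mem' := fun hx hy i => by rw [map_add, hx i, hy i, smul_add]
  zero_mem' := fun i => by simp
  smul_mem' := fun c x hx i => by rw [map_smul, hx i, smul_comm]

lemma W_gr {K D : Type*} [Field K] [DivisionRing D] [Algebra K D] {t : ℕ}
    (σ : Fin t → (D ≃ₐ[K] D)) (hcomm : ∀ i j, ∀ x : D, σ i (σ j x) = σ j (σ i x)) :
    Gr (W σ) where
  indep := by
    have h := Module.End.independent_iInf_maxGenEigenspace_of_forall_mapsTo
      (fun i => ((σ i).toLinearMap : Module.End K D)) (fun i j φ =>
        Module.End.mapsTo_maxGenEigenspace_of_comm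
          (LinearMap.ext fun x => hcomm j i x) φ)
    have h2 := h.comp (f := fun (lam : Fin t → Kˣ) i => (lam i : K)) (by
      intro a b hab
      funext i
      exact Units.ext (congrFun hab i))
    refine h2.mono fun lam u hu => ?_
    simp only [Function.comp]
    rw [Module.End.mem_iInf_maxGenEigenspace_iff]
    intro j
    refine ⟨1, ?_⟩
    have := hu j
    simp [this]
  one := fun i => by simp
  mul := fun {a b x y} hx hy i => by
    rw [map_mul, hx i, hy i]
    simp [smul_smul, mul_comm]
  inv := fun {a x} hx i => by
    rw [map_inv₀, hx i]
    by_cases hx0 : x = 0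
    · simp [hx0]
    · apply inv_eq_of_mul_eq_one_left
      simp [smul_smul, hx0]

end EvAux

/-- Let `D` be a division `K`-algebra with `D ⊗[K] Dᵐᵒᵖ` Noetherian and let
`σ₁, …, σ_t` be pairwise commuting `K`-algebra automorphisms of `D`.  Then the set of common
eigenvalue tuples in `(Kˣ)^t` is a multiplicative subgroup which is finitely generated. -/
theorem stmt3 (K D : Type*) [Field K] [DivisionRing D] [Algebra K D]
    (hNoeth : IsNoetherianRing (D ⊗[K] Dᵐᵒᵖ))
    (t : ℕ) (σ : Fin t → (D ≃ₐ[K] D))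
    (hcomm : ∀ i j, ∀ x : D, σ i (σ j x) = σ j (σ i x)) :
    ∃ G : Subgroup (Fin t → Kˣ),
      (G : Set (Fin t → Kˣ)) =
        {lam : Fin t → Kˣ | ∃ u : D, u ≠ 0 ∧ ∀ i, σ i u = (lam i : K) • u} ∧
      G.FG := by
  have hV := EvAux.W_gr σ hcomm
  let G : Subgroup (Fin t → Kˣ) :=
    { carrier := {lam : Fin t → Kˣ | ∃ u : D, u ≠ 0 ∧ ∀ i, σ i u = (lam i : K) • u}
      one_mem' := ⟨1, one_ne_zero, hV.one⟩
      mul_mem' := by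
        rintro a b ⟨u, hu0, hu⟩ ⟨v, hv0, hv⟩
        exact ⟨u * v, mul_ne_zero hu0 hv0, hV.mul hu hv⟩
      inv_mem' := by
        rintro a ⟨u, hu0, hu⟩
        exact ⟨u⁻¹, inv_ne_zero hu0, hV.inv hu⟩ }
  refine ⟨G, rfl, EvAux.fg hV hNoeth G fun g => ?_⟩
  constructor
  · rintro ⟨u, hu0, hu⟩
    exact ⟨u, hu, hu0⟩
  · rintro ⟨u, hu, hu0⟩
    exact ⟨u, hu0, hu⟩
end

section
/- Let K be a field, D a division K-algebra such that D ⊗_K D^o is a Noetherian ring, and δ₁, …, δ_t pairwise commuting K-derivations of D. Let D(Δ) be the K-linear span in D of all common eigenvectors of δ₁,…,δ_t (i.e., of all u ∈ D with δᵢ(u) = λᵢ·u for all i, for some λ ∈ K^t). Then D(Δ) is a K-subalgebra of D which is a domain and is left and right Noetherian as a ring. -/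
open TensorProduct

set_option linter.unusedSectionVars false

section SkewLaurent
variable {R S : Type*} [Ring R] [Ring S] [Module R S] (f : R →+* S)
  (hf : ∀ (r : R) (s : S), r • s = f r * s) (u : Sˣ)

def polyPart (R : Type*) {S : Type*} [Ring R] [Ring S] [Module R S] (u : Sˣ) (n : ℕ) :
    Submodule R S :=
  Submodule.span R ((fun i => (u : S) ^ i) '' Set.Iio n)

theorem polyPart_mono {m n : ℕ} (h : m ≤ n) : polyPart R u m ≤ polyPart R u n :=
  Submodule.span_mono (Set.image_mono (Set.Iio_subset_Iio h))

theorem pow_mem_polyPart {m n : ℕ} (h : m < n) : (u : S) ^ m ∈ polyPart R u n :=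
  Submodule.subset_span ⟨m, h, rfl⟩

theorem polyPart_fg (n : ℕ) : (polyPart R u n).FG :=
  Submodule.fg_span ((Set.finite_Iio n).image _)

include hf in
theorem mul_mem_polyPart (h2 : ∀ r, ∃ r', (u : S) * f r = f r' * u) {n : ℕ} {x : S}
    (hx : x ∈ polyPart R u n) : (u : S) * x ∈ polyPart R u (n + 1) := by
  induction hx using Submodule.span_induction with
  | mem x h =>
    obtain ⟨i, hi, rfl⟩ := h
    have := pow_mem_polyPart (R := R) u (Nat.succ_lt_succ hi)
    simpa [pow_succ'] using this
  | zero => simp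
  | add x y _ _ hx hy => rw [mul_add]; exact add_mem hx hy
  | smul a x _ hx =>
    obtain ⟨r', hr'⟩ := h2 a
    rw [hf, ← mul_assoc, hr', mul_assoc, ← hf]
    exact Submodule.smul_mem _ _ hx

include hf in
theorem pow_mul_mem_polyPart (h2 : ∀ r, ∃ r', (u : S) * f r = f r' * u) {n : ℕ} {x : S}
    (hx : x ∈ polyPart R u n) (k : ℕ) : (u : S) ^ k * x ∈ polyPart R u (n + k) := by
  induction k with
  | zero => simpa
  | succ k ih =>
    rw [pow_succ', mul_assoc, ← add_assoc]
    exact mul_mem_polyPart f hf u h2 ih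

theorem pow_comm1 (h2 : ∀ r, ∃ r', (u : S) * f r = f r' * u) (n : ℕ) (r : R) :
    ∃ r', (u : S) ^ n * f r = f r' * u ^ n := by
  induction n generalizing r with
  | zero => exact ⟨r, by simp⟩
  | succ n ih =>
    obtain ⟨r1, h⟩ := h2 r
    obtain ⟨r2, h'⟩ := ih r1
    exact ⟨r2, by rw [pow_succ, mul_assoc, h, ← mul_assoc, h', mul_assoc]⟩

theorem pow_comm2 (h1 : ∀ r, ∃ r', f r * (u : S) = u * f r') (n : ℕ) (r : R) :
    ∃ r', f r * (u : S) ^ n = u ^ n * f r' := by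
  induction n generalizing r with
  | zero => exact ⟨r, by simp⟩
  | succ n ih =>
    obtain ⟨r1, h⟩ := h1 r
    obtain ⟨r2, h'⟩ := ih r1
    exact ⟨r2, by rw [pow_succ', ← mul_assoc, h, mul_assoc, h', mul_assoc]⟩

include hf in
theorem pow_mul_mem (h2 : ∀ r, ∃ r', (u : S) * f r = f r' * u) (n : ℕ) (r : R) :
    (u : S) ^ n * f r ∈ polyPart R u (n + 1) := by
  obtain ⟨r', h⟩ := pow_comm1 f u h2 n r
  rw [h, ← hf]
  exact Submodule.smul_mem _ _ (pow_mem_polyPart u (Nat.lt_succ_self n))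

include hf in
theorem mem_polyPart_succ (h1 : ∀ r, ∃ r', f r * (u : S) = u * f r') {n : ℕ} {x : S}
    (hx : x ∈ polyPart R u (n + 1)) : ∃ r, ∃ p ∈ polyPart R u n, x = u ^ n * f r + p := by
  have : polyPart R u (n + 1) = Submodule.span R {(u : S) ^ n} ⊔ polyPart R u n := by
    unfold polyPart
    rw [← Submodule.span_union]
    congr 1
    ext y
    simp only [Set.mem_image, Set.mem_Iio, Set.mem_union, Set.mem_singleton_iff]
    constructor
    · rintro ⟨i, hi, rfl⟩
      rcases Nat.lt_succ_iff_lt_or_eq.mp hi with h | rfl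
      · exact Or.inr ⟨i, h, rfl⟩
      · exact Or.inl rfl
    · rintro (rfl | ⟨i, hi, rfl⟩)
      · exact ⟨n, by omega, rfl⟩
      · exact ⟨i, by omega, rfl⟩
  rw [this, Submodule.mem_sup] at hx
  obtain ⟨y, hy, p, hp, rfl⟩ := hx
  obtain ⟨a, rfl⟩ := Submodule.mem_span_singleton.mp hy
  obtain ⟨r', h⟩ := pow_comm2 f u h1 n a
  exact ⟨r', p, hp, by rw [hf, h]⟩

def leadIdeal (h2 : ∀ r, ∃ r', (u : S) * f r = f r' * u)
    (hf : ∀ (r : R) (s : S), r • s = f r * s) (I : Ideal S) (n : ℕ) : Ideal R where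
  carrier := {r | ∃ p ∈ polyPart R u n, (u : S) ^ n * f r + p ∈ I}
  zero_mem' := ⟨0, zero_mem _, by simp⟩
  add_mem' := by
    rintro a b ⟨p, hp, hpI⟩ ⟨q, hq, hqI⟩
    refine ⟨p + q, add_mem hp hq, ?_⟩
    have := I.add_mem hpI hqI
    rw [map_add, mul_add]
    convert this using 1
    abel
  smul_mem' := by
    rintro c a ⟨p, hp, hpI⟩
    obtain ⟨c', hc⟩ := pow_comm1 f u h2 n c
    refine ⟨c' • p, Submodule.smul_mem _ _ hp, ?_⟩
    have := I.mul_mem_left (f c') hpI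
    rw [smul_eq_mul, map_mul, ← mul_assoc, hc, hf, mul_assoc, ← mul_add]
    exact this

include hf in
theorem noeth_aux [IsNoetherianRing R] (h1 : ∀ r, ∃ r', f r * (u : S) = u * f r')
    (h2 : ∀ r, ∃ r', (u : S) * f r = f r' * u)
    (hspan : ∀ s : S, s ∈ AddSubgroup.closure {x : S | ∃ n : ℤ, ∃ r, x = ((u ^ n : Sˣ) : S) * f r}) :
    IsNoetherianRing S := by
  have key : ∀ s : S, ∃ k n : ℕ, (u : S) ^ k * s ∈ polyPart R u n := by
    intro s
    induction hspan s using AddSubgroup.closure_induction with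
    | mem x h =>
      obtain ⟨m, r, rfl⟩ := h
      obtain ⟨j, hj⟩ : ∃ j : ℕ, (m.natAbs : ℤ) + m = j := ⟨((m.natAbs : ℤ) + m).toNat, by omega⟩
      refine ⟨m.natAbs, j + 1, ?_⟩
      have : (u : S) ^ m.natAbs * (((u ^ m : Sˣ) : S) * f r) = u ^ j * f r := by
        rw [← mul_assoc, ← Units.val_pow_eq_pow_val, ← Units.val_mul, ← zpow_natCast, ← zpow_add,
          hj, zpow_natCast, Units.val_pow_eq_pow_val]
      rw [this]
      exact pow_mul_mem f hf u h2 j r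
    | zero => exact ⟨0, 0, by simp⟩
    | add x y _ _ hx hy =>
      obtain ⟨k, n, h⟩ := hx
      obtain ⟨k', n', h'⟩ := hy
      refine ⟨k + k', (n + k') + (n' + k), ?_⟩
      rw [mul_add]
      apply add_mem
      · rw [add_comm k k', pow_add, mul_assoc]
        exact polyPart_mono u (by omega) (pow_mul_mem_polyPart f hf u h2 h k')
      · rw [pow_add, mul_assoc]
        exact polyPart_mono u (by omega) (pow_mul_mem_polyPart f hf u h2 h' k)
    | neg x _ hx =>
      obtain ⟨k, n, h⟩ := hx
      exact ⟨k, n, by simpa using h⟩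
  constructor
  intro (I : Ideal S)
  let L : Ideal S → ℕ → Ideal R := leadIdeal f u h2 hf
  have Lmono : ∀ I : Ideal S, Monotone (L I) := by
    intro I
    apply monotone_nat_of_le_succ
    rintro n r ⟨p, hp, hpI⟩
    refine ⟨u * p, mul_mem_polyPart f hf u h2 hp, ?_⟩
    have := I.mul_mem_left (u : S) hpI
    rwa [mul_add, ← mul_assoc, ← pow_succ'] at this
  obtain ⟨N, hN⟩ := monotone_stabilizes_iff_noetherian.mpr
    (inferInstance : IsNoetherian R R) ⟨L I, Lmono I⟩
  let IR : Submodule R S :=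
    { carrier := I
      zero_mem' := I.zero_mem
      add_mem' := fun ha hb => I.add_mem ha hb
      smul_mem' := fun c x hx => by rw [hf]; exact I.mul_mem_left _ hx }
  have hfg : (IR ⊓ polyPart R u (N + 1)).FG := by
    have : IsNoetherian R (polyPart R u (N + 1)) :=
      isNoetherian_of_fg_of_noetherian _ (polyPart_fg u (N + 1))
    exact (isNoetherian_submodule.mp this) _ inf_le_right
  obtain ⟨T, hT⟩ := hfg
  refine ⟨T, ?_⟩
  set J : Ideal S := Ideal.span (T : Set S) with hJ
  have hTJ : ∀ x, x ∈ I → x ∈ polyPart R u (N + 1) → x ∈ J := by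
    intro x hx hxp
    have : x ∈ Submodule.span R (T : Set S) := by rw [hT]; exact ⟨hx, hxp⟩
    induction this using Submodule.span_induction with
    | mem x h => exact Ideal.subset_span h
    | zero => exact J.zero_mem
    | add x y hx' hy' h h' =>
      have ax : x ∈ IR ⊓ polyPart R u (N + 1) := by rw [← hT]; exact hx'
      have ay : y ∈ IR ⊓ polyPart R u (N + 1) := by rw [← hT]; exact hy'
      exact J.add_mem (h ax.1 ax.2) (h' ay.1 ay.2)
    | smul a x hx' h =>
      have ax : x ∈ IR ⊓ polyPart R u (N + 1) := by rw [← hT]; exact hx'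
      rw [hf]
      exact J.mul_mem_left _ (h ax.1 ax.2)
  have hJI : J ≤ I := by
    apply Ideal.span_le.mpr
    intro x hx
    have : x ∈ IR ⊓ polyPart R u (N + 1) := by rw [← hT]; exact Submodule.subset_span hx
    exact this.1
  have hLle : ∀ n ≤ N, L I n ≤ L J n := by
    rintro n hn r ⟨p, hp, hpI⟩
    refine ⟨p, hp, hTJ _ hpI ?_⟩
    exact add_mem (polyPart_mono u (by omega) (pow_mul_mem f hf u h2 n r))
      (polyPart_mono u (by omega) hp)
  have hL : ∀ n, L I n ≤ L J n := by
    intro n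
    rcases le_total n N with h | h
    · exact hLle n h
    · have e : L I N = L I n := hN n h
      rw [← e]
      exact (hLle N le_rfl).trans (Lmono J h)
  have main : ∀ n, ∀ x ∈ polyPart R u n, x ∈ I → x ∈ J := by
    intro n
    induction n with
    | zero =>
      intro x hx _
      have : x = 0 := by simpa [polyPart] using hx
      rw [this]; exact J.zero_mem
    | succ n ih =>
      intro x hx hxI
      obtain ⟨r, p, hp, rfl⟩ := mem_polyPart_succ f hf u h1 hx
      obtain ⟨q, hq, hqJ⟩ := hL n (show r ∈ L I n from ⟨p, hp, hxI⟩)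
      have h3 := ih (p - q) (sub_mem hp hq) (by
        have := I.sub_mem hxI (hJI hqJ)
        simpa using this)
      have := J.add_mem hqJ h3
      convert this using 1
      abel
  apply le_antisymm hJI
  intro x hx
  obtain ⟨k, n, h⟩ := key x
  have := main n _ h (I.mul_mem_left _ hx)
  have := J.mul_mem_left ((u⁻¹ ^ k : Sˣ) : S) this
  rwa [← mul_assoc, ← Units.val_pow_eq_pow_val, ← Units.val_mul, inv_pow, inv_mul_cancel,
    Units.val_one, one_mul] at this

end SkewLaurent

theorem noeth_skew {R S : Type*} [Ring R] [Ring S] (f : R →+* S) (u : Sˣ)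
    (hR : IsNoetherianRing R) (h1 : ∀ r, ∃ r', f r * (u : S) = u * f r')
    (h2 : ∀ r, ∃ r', (u : S) * f r = f r' * u)
    (hspan : ∀ s : S, s ∈ AddSubgroup.closure {x : S | ∃ n : ℤ, ∃ r, x = ((u ^ n : Sˣ) : S) * f r}) :
    IsNoetherianRing S := by
  let _ : Module R S := Module.compHom S f
  exact noeth_aux f (fun _ _ => rfl) u h1 h2 hspan

theorem noeth_skew_op {R S : Type*} [Ring R] [Ring S] (f : R →+* S) (u : Sˣ)
    (hR : IsNoetherianRing Rᵐᵒᵖ) (h1 : ∀ r, ∃ r', f r * (u : S) = u * f r')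
    (h2 : ∀ r, ∃ r', (u : S) * f r = f r' * u)
    (hspan : ∀ s : S, s ∈ AddSubgroup.closure {x : S | ∃ n : ℤ, ∃ r, x = f r * ((u ^ n : Sˣ) : S)}) :
    IsNoetherianRing Sᵐᵒᵖ := by
  let v : (Sᵐᵒᵖ)ˣ := Units.opEquiv.symm (MulOpposite.op u)
  have hv : (v : Sᵐᵒᵖ) = MulOpposite.op (u : S) := rfl
  refine noeth_skew f.op v hR ?_ ?_ ?_
  · intro r
    obtain ⟨r', h⟩ := h2 r.unop
    refine ⟨MulOpposite.op r', ?_⟩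
    rw [hv]
    apply MulOpposite.unop_injective
    simpa using h
  · intro r
    obtain ⟨r', h⟩ := h1 r.unop
    refine ⟨MulOpposite.op r', ?_⟩
    rw [hv]
    apply MulOpposite.unop_injective
    simpa using h
  · intro s
    have : ∀ x : S, x ∈ AddSubgroup.closure {x : S | ∃ n : ℤ, ∃ r, x = f r * ((u ^ n : Sˣ) : S)} →
        MulOpposite.op x ∈ AddSubgroup.closure
          {x : Sᵐᵒᵖ | ∃ n : ℤ, ∃ r, x = ((v ^ n : (Sᵐᵒᵖ)ˣ) : Sᵐᵒᵖ) * f.op r} := by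
      intro x hx
      induction hx using AddSubgroup.closure_induction with
      | mem x h =>
        obtain ⟨n, r, rfl⟩ := h
        apply AddSubgroup.subset_closure
        refine ⟨n, MulOpposite.op r, ?_⟩
        have : ((v ^ n : (Sᵐᵒᵖ)ˣ) : Sᵐᵒᵖ) = MulOpposite.op ((u ^ n : Sˣ) : S) := by
          have : v ^ n = Units.opEquiv.symm (MulOpposite.op (u ^ n)) := by
            simp [v, MulOpposite.op_zpow]
          rw [this]; rfl
        rw [this]
        rfl
      | zero => exact zero_mem _
      | add x y _ _ hx hy => exact add_mem hx hy
      | neg x _ hx => exact neg_mem hx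
    exact this _ (hspan s.unop)

section Weights
variable {K D : Type*} [Field K] [DivisionRing D] [Algebra K D] {t : ℕ}
  (δ : Fin t → (D →ₗ[K] D))

def Wt (lam : Fin t → K) (u : D) : Prop := ∀ i, δ i u = lam i • u

def DH (H : AddSubgroup (Fin t → K)) : Subalgebra K D :=
  Algebra.adjoin K {u : D | ∃ lam ∈ H, Wt δ lam u}

variable {δ} (hLeib : ∀ i, ∀ a b : D, δ i (a * b) = δ i a * b + a * δ i b)

include hLeib

theorem Wt.one : Wt δ 0 (1 : D) := by
  intro i
  have := hLeib i 1 1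
  simp only [mul_one, one_mul] at this
  simpa using this

theorem Wt.mul {a b : Fin t → K} {u v : D} (hu : Wt δ a u) (hv : Wt δ b v) :
    Wt δ (a + b) (u * v) := by
  intro i
  rw [hLeib, hu i, hv i, Pi.add_apply, add_smul, smul_mul_assoc, mul_smul_comm]

theorem Wt.inv {a : Fin t → K} {u : D} (hu : Wt δ a u) (h0 : u ≠ 0) :
    Wt δ (-a) u⁻¹ := by
  intro i
  have h := hLeib i u u⁻¹
  rw [mul_inv_cancel₀ h0, Wt.one hLeib i, hu i] at h
  apply mul_left_cancel₀ h0
  simp only [Pi.zero_apply, zero_smul] at h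
  rw [eq_comm, add_comm, ← eq_neg_iff_add_eq_zero] at h
  rw [h]
  simp

theorem Wt.pow {a : Fin t → K} {u : D} (hu : Wt δ a u) (n : ℕ) :
    Wt δ (n • a) (u ^ n) := by
  induction n with
  | zero => simpa using Wt.one hLeib
  | succ n ih => rw [pow_succ, succ_nsmul]; exact Wt.mul hLeib ih hu

theorem Wt.zpow {a : Fin t → K} {u : D} (hu : Wt δ a u) (h0 : u ≠ 0) (n : ℤ) :
    Wt δ (n • a) (u ^ n) := by
  cases n with
  | ofNat n => simpa using Wt.pow hLeib hu n
  | negSucc n =>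
    rw [zpow_negSucc, negSucc_zsmul]
    exact Wt.inv hLeib (Wt.pow hLeib hu _) (pow_ne_zero _ h0)

theorem DH_toSubmodule (H : AddSubgroup (Fin t → K)) :
    Subalgebra.toSubmodule (DH δ H) = Submodule.span K {u : D | ∃ lam ∈ H, Wt δ lam u} := by
  let M : Submonoid D :=
    { carrier := {u : D | ∃ lam ∈ H, Wt δ lam u}
      one_mem' := ⟨0, H.zero_mem, Wt.one hLeib⟩
      mul_mem' := by
        rintro a b ⟨l, hl, ha⟩ ⟨m, hm, hb⟩
        exact ⟨l + m, H.add_mem hl hm, Wt.mul hLeib ha hb⟩ }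
  have := Algebra.adjoin_eq_span K (M : Set D)
  rw [Submonoid.closure_eq] at this
  exact this

theorem mem_DH_iff {H : AddSubgroup (Fin t → K)} {x : D} :
    x ∈ DH δ H ↔ x ∈ Submodule.span K {u : D | ∃ lam ∈ H, Wt δ lam u} := by
  rw [← DH_toSubmodule hLeib]; rfl

theorem conj_mem_DH {H : AddSubgroup (Fin t → K)} {a : Fin t → K} {u : D} (hu : Wt δ a u)
    (h0 : u ≠ 0) {x : D} (hx : x ∈ DH δ H) : u * x * u⁻¹ ∈ DH δ H := by
  rw [mem_DH_iff hLeib] at hx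
  induction hx using Submodule.span_induction with
  | mem x h =>
    obtain ⟨l, hl, hx⟩ := h
    apply Algebra.subset_adjoin
    refine ⟨l, hl, ?_⟩
    have := Wt.mul hLeib (Wt.mul hLeib hu hx) (Wt.inv hLeib hu h0)
    rwa [add_comm a l, add_neg_cancel_right] at this
  | zero => simp
  | add x y _ _ hx hy => rw [mul_add, add_mul]; exact add_mem hx hy
  | smul c x _ hx =>
    rw [mul_smul_comm, smul_mul_assoc]
    exact Subalgebra.smul_mem _ hx c

omit hLeib in
theorem DH_mono {H H' : AddSubgroup (Fin t → K)} (h : H ≤ H') : DH δ H ≤ DH δ H' :=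
  Algebra.adjoin_mono (fun _ ⟨l, hl, hu⟩ => ⟨l, h hl, hu⟩)

omit hLeib in
theorem Wt.mem_DH {H : AddSubgroup (Fin t → K)} {a : Fin t → K} (ha : a ∈ H) {u : D}
    (hu : Wt δ a u) : u ∈ DH δ H := Algebra.subset_adjoin ⟨a, ha, hu⟩

omit hLeib in
theorem exists_incl {A B : Subalgebra K D} (h : A ≤ B) :
    ∃ f : A →+* B, ∀ r, ((f r : B) : D) = r :=
  ⟨(Subalgebra.inclusion h).toRingHom, fun _ => rfl⟩

omit hLeib in
theorem exists_unit (B : Subalgebra K D) {u : D} (h0 : u ≠ 0) (hu : u ∈ B) (hui : u⁻¹ ∈ B) :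
    ∃ U : Bˣ, ((U : B) : D) = u ∧ (((U⁻¹ : Bˣ) : B) : D) = u⁻¹ :=
  ⟨{ val := ⟨u, hu⟩
     inv := ⟨u⁻¹, hui⟩
     val_inv := Subtype.ext (mul_inv_cancel₀ h0)
     inv_val := Subtype.ext (inv_mul_cancel₀ h0) }, rfl, rfl⟩

theorem DH_step (H : AddSubgroup (Fin t → K)) {a : Fin t → K} {u : D} (hu : Wt δ a u)
    (h0 : u ≠ 0) (h1 : IsNoetherianRing (DH δ H)) (h2 : IsNoetherianRing (DH δ H)ᵐᵒᵖ)
    {H' : AddSubgroup (Fin t → K)} (hH' : H' = AddSubgroup.closure {a} ⊔ H) :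
    IsNoetherianRing (DH δ H') ∧ IsNoetherianRing (DH δ H')ᵐᵒᵖ := by
  have hle : H ≤ H' := hH' ▸ le_sup_right
  have haH' : a ∈ H' := by
    rw [hH']
    exact AddSubgroup.mem_sup_left (AddSubgroup.subset_closure rfl)
  obtain ⟨f, hfv⟩ := exists_incl (DH_mono (δ := δ) hle)
  obtain ⟨U, hU, hUi⟩ := exists_unit (DH δ H') h0 (Wt.mem_DH haH' hu)
    (Wt.mem_DH (H'.neg_mem haH') (Wt.inv hLeib hu h0))
  have hUz : ∀ n : ℤ, (((U ^ n : (DH δ H')ˣ) : DH δ H') : D) = u ^ n := by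
    intro n
    cases n with
    | ofNat n =>
      rw [Int.ofNat_eq_natCast, zpow_natCast, zpow_natCast, Units.val_pow_eq_pow_val,
        SubmonoidClass.coe_pow, hU]
    | negSucc n =>
      rw [zpow_negSucc, zpow_negSucc, ← inv_pow, ← inv_pow, Units.val_pow_eq_pow_val,
        SubmonoidClass.coe_pow, hUi]
  have c1 : ∀ r, ∃ r', f r * (U : DH δ H') = U * f r' := by
    intro r
    have := conj_mem_DH hLeib (Wt.inv hLeib hu h0) (inv_ne_zero h0) r.2
    refine ⟨⟨_, this⟩, Subtype.ext ?_⟩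
    rw [Subalgebra.coe_mul, Subalgebra.coe_mul, hU, hfv, hfv]
    simp only [inv_inv]
    rw [mul_assoc, mul_inv_cancel_left₀ h0]
  have c2 : ∀ r, ∃ r', (U : DH δ H') * f r = f r' * U := by
    intro r
    have := conj_mem_DH hLeib hu h0 r.2
    refine ⟨⟨_, this⟩, Subtype.ext ?_⟩
    rw [Subalgebra.coe_mul, Subalgebra.coe_mul, hU, hfv, hfv, inv_mul_cancel_right₀ h0]
  have gen : ∀ T : Set (DH δ H'),
      (∀ x : DH δ H', ∀ (h : AddSubgroup (Fin t → K)) , (∃ l ∈ H', Wt δ l (x : D)) → x ∈ T) →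
      ∀ s, s ∈ AddSubgroup.closure T := by
    intro T hT s
    have : ∀ x : D, ∀ hx : x ∈ Submodule.span K {u : D | ∃ lam ∈ H', Wt δ lam u},
        ∀ c : K, ∃ hh : c • x ∈ DH δ H', (⟨c • x, hh⟩ : DH δ H') ∈ AddSubgroup.closure T := by
      intro x hx
      induction hx using Submodule.span_induction with
      | mem x h =>
        intro c
        obtain ⟨l, hl, hx⟩ := h
        have hw : Wt δ l (c • x) := fun i => by rw [map_smul, hx i, smul_comm]
        exact ⟨Wt.mem_DH hl hw, AddSubgroup.subset_closure (hT _ H ⟨l, hl, hw⟩)⟩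
      | zero =>
        intro c
        refine ⟨by simp, ?_⟩
        convert zero_mem (AddSubgroup.closure T)
        simp
      | add x y _ _ hx hy =>
        intro c
        obtain ⟨p, hp⟩ := hx c
        obtain ⟨q, hq⟩ := hy c
        refine ⟨by rw [smul_add]; exact add_mem p q, ?_⟩
        convert add_mem hp hq using 1
        exact Subtype.ext (smul_add _ _ _)
      | smul d x _ hx =>
        intro c
        simpa only [smul_smul] using hx (c * d)
    obtain ⟨_, h⟩ := this s ((mem_DH_iff hLeib).mp s.2) 1
    convert h
    simp
  have dec : ∀ l ∈ H', ∃ n : ℤ, ∃ h ∈ H, l = n • a + h := by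
    intro l hl
    rw [hH'] at hl
    obtain ⟨y, hy, h, hh, rfl⟩ := AddSubgroup.mem_sup.mp hl
    obtain ⟨n, rfl⟩ := AddSubgroup.mem_closure_singleton.mp hy
    exact ⟨n, h, hh, rfl⟩
  constructor
  · refine noeth_skew f U h1 c1 c2 (gen _ ?_)
    rintro x - ⟨l, hl, hx⟩
    obtain ⟨n, h, hh, rfl⟩ := dec l hl
    have hm := Wt.mul hLeib (Wt.zpow hLeib hu h0 (-n)) hx
    rw [neg_zsmul, neg_add_cancel_left] at hm
    refine ⟨n, ⟨_, Wt.mem_DH hh hm⟩, Subtype.ext ?_⟩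
    rw [Subalgebra.coe_mul, hUz, hfv, ← mul_assoc, ← zpow_add₀ h0]
    simp
  · refine noeth_skew_op f U h2 c1 c2 (gen _ ?_)
    rintro x - ⟨l, hl, hx⟩
    obtain ⟨n, h, hh, rfl⟩ := dec l hl
    have hm := Wt.mul hLeib hx (Wt.zpow hLeib hu h0 (-n))
    rw [neg_zsmul, add_comm (n • a), add_neg_cancel_right] at hm
    refine ⟨n, ⟨_, Wt.mem_DH hh hm⟩, Subtype.ext ?_⟩
    rw [Subalgebra.coe_mul, hUz, hfv, mul_assoc, ← zpow_add₀ h0]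
    simp

theorem DH_bot : IsNoetherianRing (DH δ ⊥) ∧ IsNoetherianRing (DH δ ⊥)ᵐᵒᵖ := by
  have hw : ∀ x ∈ DH δ ⊥, Wt δ 0 x := by
    intro x hx
    rw [mem_DH_iff hLeib] at hx
    induction hx using Submodule.span_induction with
    | mem x h =>
      obtain ⟨l, hl, hx⟩ := h
      rw [AddSubgroup.mem_bot] at hl
      rwa [hl] at hx
    | zero => intro i; simp
    | add x y _ _ hx hy => intro i; rw [map_add, hx i, hy i, smul_add]
    | smul c x _ hx => intro i; rw [map_smul, hx i, smul_comm]
  let _ : DivisionRing (DH δ ⊥) := DivisionRing.ofIsUnitOrEqZero (by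
    intro x
    by_cases h : x = 0
    · exact Or.inr h
    · left
      have h0 : (x : D) ≠ 0 := fun h' => h (Subtype.ext h')
      have hi := Wt.inv hLeib (hw x x.2) h0
      exact ⟨⟨x, ⟨_, Wt.mem_DH (AddSubgroup.mem_bot.mpr neg_zero) hi⟩,
        Subtype.ext (mul_inv_cancel₀ h0), Subtype.ext (inv_mul_cancel₀ h0)⟩, rfl⟩)
  constructor <;> infer_instance

theorem DH_noeth (s : Finset (Fin t → K)) (hs : ∀ a ∈ s, ∃ u : D, u ≠ 0 ∧ Wt δ a u) :
    IsNoetherianRing (DH δ (AddSubgroup.closure (s : Set (Fin t → K)))) ∧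
    IsNoetherianRing (DH δ (AddSubgroup.closure (s : Set (Fin t → K))))ᵐᵒᵖ := by
  classical
  induction s using Finset.induction_on with
  | empty =>
    rw [Finset.coe_empty, AddSubgroup.closure_empty]
    exact DH_bot hLeib
  | insert a s _ ih =>
    obtain ⟨i1, i2⟩ := ih (fun b hb => hs b (Finset.mem_insert_of_mem hb))
    obtain ⟨u, h0, hu⟩ := hs a (Finset.mem_insert_self _ _)
    refine DH_step hLeib _ hu h0 i1 i2 ?_
    rw [Finset.coe_insert, Set.insert_eq, AddSubgroup.closure_union]

/-- elements of the division closure have denominators -/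
theorem closure_denom (H : AddSubgroup (Fin t → K)) (hN : IsNoetherianRing (DH δ H)) (x : D)
    (hx : x ∈ Subfield.closure (DH δ H : Set D)) :
    ∃ q ∈ DH δ H, q ≠ 0 ∧ q * x ∈ DH δ H := by
  have ore : ∀ p ∈ DH δ H, ∀ q ∈ DH δ H, q ≠ 0 →
      ∃ a ∈ DH δ H, ∃ b ∈ DH δ H, a ≠ 0 ∧ a * p = b * q := by
    intro p hp q hq hq0
    obtain ⟨o⟩ := nonempty_oreSet_of_strongRankCondition (R := DH δ H)
    let Q : nonZeroDivisors (DH δ H) := ⟨⟨q, hq⟩, mem_nonZeroDivisors_of_ne_zero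
      (fun h => hq0 (congrArg Subtype.val h))⟩
    let d : nonZeroDivisors (DH δ H) := OreLocalization.oreDenom (⟨p, hp⟩ : DH δ H) Q
    let e : DH δ H := OreLocalization.oreNum (⟨p, hp⟩ : DH δ H) Q
    have hde : (d : DH δ H) * ⟨p, hp⟩ = e * (Q : DH δ H) :=
      OreLocalization.ore_eq (⟨p, hp⟩ : DH δ H) Q
    refine ⟨((d : DH δ H) : D), (d : DH δ H).2, (e : D), e.2, ?_, congrArg Subtype.val hde⟩
    intro h
    exact nonZeroDivisors.ne_zero d.2 (Subtype.ext h)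
  induction hx using Subfield.closure_induction with
  | mem x h => exact ⟨1, one_mem _, one_ne_zero, by simpa using h⟩
  | one => exact ⟨1, one_mem _, one_ne_zero, by simpa using one_mem _⟩
  | add x y _ _ hx hy =>
    obtain ⟨q, hq, q0, hqx⟩ := hx
    obtain ⟨r, hr, r0, hry⟩ := hy
    obtain ⟨a, ha, b, hb, a0, hab⟩ := ore q hq r hr r0
    refine ⟨a * q, mul_mem ha hq, mul_ne_zero a0 q0, ?_⟩
    rw [mul_add]
    refine add_mem ?_ ?_
    · rw [mul_assoc]; exact mul_mem ha hqx
    · rw [hab, mul_assoc]; exact mul_mem hb hry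
  | neg x _ hx =>
    obtain ⟨q, hq, q0, hqx⟩ := hx
    exact ⟨q, hq, q0, by simpa using hqx⟩
  | inv x _ hx =>
    by_cases x0 : x = 0
    · exact ⟨1, one_mem _, one_ne_zero, by simp [x0]⟩
    obtain ⟨q, hq, q0, hqx⟩ := hx
    exact ⟨q * x, hqx, mul_ne_zero q0 x0, by rwa [mul_inv_cancel_right₀ x0]⟩
  | mul x y _ _ hx hy =>
    obtain ⟨q, hq, q0, hqx⟩ := hx
    obtain ⟨r, hr, r0, hry⟩ := hy
    obtain ⟨a, ha, b, hb, a0, hab⟩ := ore _ hqx r hr r0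
    refine ⟨a * q, mul_mem ha hq, mul_ne_zero a0 q0, ?_⟩
    rw [← mul_assoc, mul_assoc a, hab, mul_assoc]
    exact mul_mem hb hry

theorem not_mem_closure (hcomm : ∀ i j, ∀ x : D, δ i (δ j x) = δ j (δ i x))
    (H : AddSubgroup (Fin t → K)) (hN : IsNoetherianRing (DH δ H)) {a : Fin t → K} (ha : a ∉ H)
    {u : D} (h0 : u ≠ 0) (hu : Wt δ a u) : u ∉ Subfield.closure (DH δ H : Set D) := by
  intro hmem
  obtain ⟨q, hq, q0, hqu⟩ := closure_denom hLeib H hN u hmem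
  let W : (Fin t → K) → Submodule K D := fun χ => ⨅ i, Module.End.maxGenEigenspace (δ i) (χ i)
  have hW : iSupIndep W := by
    refine Module.End.independent_iInf_maxGenEigenspace_of_forall_mapsTo δ ?_
    intro i j φ
    exact Module.End.mapsTo_maxGenEigenspace_of_comm (LinearMap.ext fun x => hcomm j i x) φ
  have hWt : ∀ χ x, Wt δ χ x → x ∈ W χ := by
    intro χ x hx
    refine (Submodule.mem_iInf _).mpr fun i => ?_
    rw [Module.End.mem_maxGenEigenspace]
    exact ⟨1, by simp [hx i]⟩
  have hdis : Disjoint (H : Set (Fin t → K)) {χ | χ - a ∈ H} := by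
    rw [Set.disjoint_left]
    intro χ h1 h2
    apply ha
    have := H.sub_mem h1 h2
    simpa using this
  have hd := hW.disjoint_biSup_biSup hdis
  have m1 : q * u ∈ ⨆ i ∈ (H : Set (Fin t → K)), W i := by
    rw [mem_DH_iff hLeib] at hqu
    refine (Submodule.span_le.mpr ?_) hqu
    rintro x ⟨l, hl, hx⟩
    exact Submodule.mem_iSup_of_mem l (Submodule.mem_iSup_of_mem hl (hWt _ _ hx))
  have m2 : ∀ x ∈ DH δ H, x * u ∈ ⨆ i ∈ {χ | χ - a ∈ H}, W i := by
    intro x hx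
    rw [mem_DH_iff hLeib] at hx
    induction hx using Submodule.span_induction with
    | mem x h =>
      obtain ⟨l, hl, hx⟩ := h
      refine Submodule.mem_iSup_of_mem (l + a) (Submodule.mem_iSup_of_mem ?_
        (hWt _ _ (Wt.mul hLeib hx hu)))
      simpa using hl
    | zero => simp
    | add x y _ _ hx hy => rw [add_mul]; exact add_mem hx hy
    | smul c x _ hx => rw [smul_mul_assoc]; exact Submodule.smul_mem _ _ hx
  exact mul_ne_zero q0 h0 (Submodule.disjoint_def.mp hd _ m1 (m2 q hq))

omit hLeib in
theorem not_mem_Jd (A : Subalgebra K D) {u : D} (hu : u ∉ Subfield.closure (A : Set D)) :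
    u ⊗ₜ[K] (1 : Dᵐᵒᵖ) - (1 : D) ⊗ₜ[K] MulOpposite.op u ∉
      Ideal.span {x : D ⊗[K] Dᵐᵒᵖ | ∃ a ∈ A, x = a ⊗ₜ 1 - 1 ⊗ₜ MulOpposite.op a} := by
  set E := Subfield.closure (A : Set D) with hE
  have hu' : u ∉ Submodule.span E {(1 : D)} := by
    intro h
    obtain ⟨e, rfl⟩ := Submodule.mem_span_singleton.mp h
    apply hu
    have : e • (1 : D) = e := mul_one _
    rw [this]
    exact e.2
  obtain ⟨f, hfu, hf⟩ := Submodule.exists_le_ker_of_notMem hu'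
  have hf1 : f 1 = 0 := hf (Submodule.subset_span rfl)
  have hAE : ∀ a ∈ A, a ∈ E := fun a ha => Subfield.subset_closure ha
  have hlin : ∀ a ∈ A, ∀ x : D, ((f (a * x) : E) : D) = a * f x := by
    intro a ha x
    have := f.map_smul (⟨a, hAE a ha⟩ : E) x
    exact congrArg Subtype.val this
  let g : D →ₗ[K] D :=
    { toFun := fun x => f x
      map_add' := fun x y => by simp
      map_smul' := fun c x => by
        rw [Algebra.smul_def, hlin _ (A.algebraMap_mem c), RingHom.id_apply, Algebra.smul_def] }
  let gop : Dᵐᵒᵖ →ₗ[K] D := g ∘ₗ (MulOpposite.opLinearEquiv K).symm.toLinearMap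
  let Φ : D ⊗[K] Dᵐᵒᵖ →ₗ[K] D := LinearMap.mul' K D ∘ₗ TensorProduct.map LinearMap.id gop
  have hΦ : ∀ (a : D) (b : Dᵐᵒᵖ), Φ (a ⊗ₜ b) = a * f b.unop := fun a b => rfl
  intro hmem
  have : ∀ x ∈ Ideal.span {x : D ⊗[K] Dᵐᵒᵖ | ∃ a ∈ A, x = a ⊗ₜ 1 - 1 ⊗ₜ MulOpposite.op a},
      ∀ z, Φ (z * x) = 0 := by
    intro x hx
    induction hx using Submodule.span_induction with
    | mem x h =>
      obtain ⟨a, ha, rfl⟩ := h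
      intro z
      induction z using TensorProduct.induction_on with
      | zero => simp
      | tmul c d =>
        rw [mul_sub, Algebra.TensorProduct.tmul_mul_tmul, Algebra.TensorProduct.tmul_mul_tmul,
          map_sub, hΦ, hΦ, mul_one, mul_one, MulOpposite.unop_mul, MulOpposite.unop_op, hlin a ha,
          mul_assoc, sub_self]
      | add x y hx hy => rw [add_mul, map_add, hx, hy, add_zero]
    | zero => simp
    | add x y _ _ hx hy => intro z; rw [mul_add, map_add, hx, hy, add_zero]
    | smul c x _ hx => intro z; rw [smul_eq_mul, ← mul_assoc]; exact hx _
  have h := this _ hmem 1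
  rw [one_mul, map_sub, hΦ, hΦ] at h
  simp only [MulOpposite.unop_one, hf1, MulOpposite.unop_op, one_mul] at h
  apply hfu
  apply Subtype.ext
  simpa using h

end Weights

theorem stmt4 (K D : Type*) [Field K] [DivisionRing D] [Algebra K D]
    (hNoeth : IsNoetherianRing (D ⊗[K] Dᵐᵒᵖ))
    (t : ℕ) (δ : Fin t → (D →ₗ[K] D))
    (hLeib : ∀ i, ∀ a b : D, δ i (a * b) = δ i a * b + a * δ i b)
    (hcomm : ∀ i j, ∀ x : D, δ i (δ j x) = δ j (δ i x)) :
    ∃ S : Subalgebra K D,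
      (S : Set D) =
        (Submodule.span K {u : D | ∃ lam : Fin t → K, ∀ i, δ i u = lam i • u} : Set D) ∧
      IsDomain S ∧ IsNoetherianRing S ∧ IsNoetherianRing Sᵐᵒᵖ := by
  classical
  let Jd : AddSubgroup (Fin t → K) → Ideal (D ⊗[K] Dᵐᵒᵖ) := fun H =>
    Ideal.span {x : D ⊗[K] Dᵐᵒᵖ | ∃ a ∈ DH δ H, x = a ⊗ₜ 1 - 1 ⊗ₜ MulOpposite.op a}
  let F : Set (Ideal (D ⊗[K] Dᵐᵒᵖ)) :=
    {J | ∃ s : Finset (Fin t → K), (∀ a ∈ s, ∃ u : D, u ≠ 0 ∧ Wt δ a u) ∧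
      J = Jd (AddSubgroup.closure (s : Set (Fin t → K)))}
  have hF : F.Nonempty := ⟨_, ∅, by simp, rfl⟩
  obtain ⟨J, ⟨s, hs, rfl⟩, hmax⟩ := set_has_maximal_iff_noetherian.mpr hNoeth F hF
  obtain ⟨n1, n2⟩ := DH_noeth hLeib s hs
  have hall : ∀ (a : Fin t → K) (u : D), u ≠ 0 → Wt δ a u →
      a ∈ AddSubgroup.closure (s : Set (Fin t → K)) := by
    intro a u h0 hu
    by_contra ha
    have hnot := not_mem_Jd (DH δ _) (not_mem_closure hLeib hcomm _ n1 ha h0 hu)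
    refine hmax (Jd (AddSubgroup.closure ((insert a s : Finset _) : Set (Fin t → K))))
      ⟨insert a s, ?_, rfl⟩ ?_
    · intro b hb
      rcases Finset.mem_insert.mp hb with rfl | hb
      · exact ⟨u, h0, hu⟩
      · exact hs b hb
    · refine lt_of_le_of_ne ?_ ?_
      · apply Ideal.span_mono
        rintro x ⟨b, hb, rfl⟩
        exact ⟨b, DH_mono (AddSubgroup.closure_mono (by simp)) hb, rfl⟩
      · intro heq
        apply hnot
        have : u ⊗ₜ[K] (1 : Dᵐᵒᵖ) - (1 : D) ⊗ₜ[K] MulOpposite.op u ∈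
            Jd (AddSubgroup.closure ((insert a s : Finset _) : Set (Fin t → K))) :=
          Ideal.subset_span ⟨u, Wt.mem_DH (AddSubgroup.subset_closure (by simp)) hu, rfl⟩
        rw [← heq] at this
        exact this
  refine ⟨DH δ (AddSubgroup.closure (s : Set (Fin t → K))), ?_, inferInstance, n1, n2⟩
  have hset : {u : D | ∃ lam : Fin t → K, ∀ i, δ i u = lam i • u} =
      {u : D | ∃ lam ∈ AddSubgroup.closure (s : Set (Fin t → K)), Wt δ lam u} := by
    ext u
    constructor
    · rintro ⟨l, hl⟩
      by_cases h0 : u = 0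
      · exact ⟨0, zero_mem _, fun i => by simp [h0]⟩
      · exact ⟨l, hall l u h0 hl, hl⟩
    · rintro ⟨l, _, hl⟩
      exact ⟨l, hl⟩
  rw [hset]
  ext x
  exact mem_DH_iff hLeib
end

section
/- Let K be a field, D a division K-algebra such that D ⊗_K D^o is a Noetherian ring, and σ₁, …, σ_t pairwise commuting K-algebra automorphisms of D. Let D(Δ) be the K-linear span in D of all common eigenvectors of σ₁,…,σ_t (i.e., of all u ∈ D with σᵢ(u) = λᵢ·u for all i, for some λ ∈ (K^×)^t). Then D(Δ) is a K-subalgebra of D which is a domain and is left and right Noetherian as a ring. -/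
open TensorProduct

theorem ore_aux {S : Type*} [Ring S] [IsDomain S] [IsNoetherianRing S] (a b : S) (ha : a ≠ 0) :
    ∃ c d : S, d ≠ 0 ∧ d * b = c * a := by
  by_contra hcon
  push Not at hcon
  have h0 : ∀ c d : S, d * b = c * a → d = 0 := fun c d h => by
    by_contra hd
    exact hcon c d hd h
  have key : ∀ (n : ℕ) (s : ℕ → S), ∑ i ∈ Finset.range n, s i * (b * a ^ i) = 0 →
      ∀ i < n, s i = 0 := by
    intro n
    induction n with
    | zero => intro s _ i hi; omega
    | succ n ih =>
      intro s hs
      rw [Finset.sum_range_succ'] at hs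
      have e : ∑ i ∈ Finset.range n, s (i + 1) * (b * a ^ (i + 1)) =
          (∑ i ∈ Finset.range n, s (i + 1) * (b * a ^ i)) * a := by
        rw [Finset.sum_mul]
        exact Finset.sum_congr rfl fun i _ => by rw [pow_succ]; simp only [mul_assoc]
      rw [e] at hs
      have hs0 : s 0 = 0 := by
        apply h0 (-(∑ i ∈ Finset.range n, s (i + 1) * (b * a ^ i)))
        rw [neg_mul, eq_neg_iff_add_eq_zero, add_comm]
        simpa using hs
      rw [hs0, zero_mul, add_zero] at hs
      have := ih (fun i => s (i + 1)) ((mul_eq_zero.1 hs).resolve_right ha)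
      intro i hi
      rcases i with _ | i
      · exact hs0
      · exact this i (by omega)
  have hli : LinearIndependent S (fun i : ℕ => b * a ^ i) := by
    rw [linearIndependent_iff']
    intro s g hg i hi
    classical
    obtain ⟨n, hn⟩ := s.exists_nat_subset_range
    have := key n (fun i => if i ∈ s then g i else 0) (by
      refine Eq.trans ?_ hg
      rw [← Finset.sum_subset hn]
      · exact Finset.sum_congr rfl fun j hj => by simp [hj]
      · intro j _ hj
        simp [hj]) i (by simpa using hn hi)
    simpa [hi] using this
  have := hli.finite_of_isNoetherian
  exact not_finite ℕ

theorem hilbert_aux {K D : Type*} [Field K] [DivisionRing D] [Algebra K D]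
    (R S : Subalgebra K D) (hRS : R ≤ S) [hR : IsNoetherianRing R] (u : D) (hu : u ≠ 0)
    (huS : u ∈ S) (huS' : u⁻¹ ∈ S) (h1 : ∀ r ∈ R, u * r * u⁻¹ ∈ R)
    (h2 : ∀ r ∈ R, u⁻¹ * r * u ∈ R)
    (hgen : ∀ s ∈ S, ∃ (k n : ℕ) (r : ℕ → D), (∀ i, r i ∈ R) ∧
      u ^ k * s = ∑ i ∈ Finset.range n, u ^ i * r i) : IsNoetherianRing S := by
  have h1' : ∀ (n : ℕ), ∀ r ∈ R, ∃ r' ∈ R, r' * u ^ n = u ^ n * r := by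
    intro n
    induction n with
    | zero => intro r hr; exact ⟨r, hr, by simp⟩
    | succ n ih =>
      intro r hr
      obtain ⟨r', hr', e⟩ := ih r hr
      refine ⟨_, h1 _ hr', ?_⟩
      rw [pow_succ', mul_assoc u (u ^ n) r, ← e]
      simp [mul_assoc, hu]
  have h2' : ∀ (n : ℕ), ∀ r ∈ R, ∃ r' ∈ R, r * u ^ n = u ^ n * r' := by
    intro n
    induction n with
    | zero => intro r hr; exact ⟨r, hr, by simp⟩
    | succ n ih =>
      intro r hr
      obtain ⟨r', hr', e⟩ := ih r hr
      refine ⟨_, h2 _ hr', ?_⟩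
      rw [pow_succ, ← mul_assoc, e]
      simp [mul_assoc, hu]
  -- polynomials of degree `< n`
  let P : ℕ → AddSubgroup D := fun n =>
    { carrier := {x | ∃ r : ℕ → D, (∀ i, r i ∈ R) ∧ x = ∑ i ∈ Finset.range n, u ^ i * r i}
      zero_mem' := ⟨0, fun _ => R.zero_mem, by simp⟩
      add_mem' := by
        rintro _ _ ⟨r, hr, rfl⟩ ⟨r', hr', rfl⟩
        exact ⟨r + r', fun i => R.add_mem (hr i) (hr' i), by
          simp [mul_add, Finset.sum_add_distrib]⟩
      neg_mem' := by
        rintro _ ⟨r, hr, rfl⟩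
        exact ⟨-r, fun i => R.neg_mem (hr i), by simp⟩ }
  have memP : ∀ n x, x ∈ P n ↔
      ∃ r : ℕ → D, (∀ i, r i ∈ R) ∧ x = ∑ i ∈ Finset.range n, u ^ i * r i := fun n x => Iff.rfl
  have PR : ∀ n, ∀ x ∈ P n, ∀ r ∈ R, r * x ∈ P n := by
    rintro n _ ⟨r, hr, rfl⟩ s hs
    choose f hf hf' using fun i => h2' i s hs
    refine ⟨fun i => f i * r i, fun i => R.mul_mem (hf i) (hr i), ?_⟩
    rw [Finset.mul_sum]
    exact Finset.sum_congr rfl fun i _ => by rw [← mul_assoc, hf', mul_assoc]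
  have Pu : ∀ n, ∀ x ∈ P n, u * x ∈ P (n + 1) := by
    rintro n _ ⟨r, hr, rfl⟩
    refine ⟨fun i => if i = 0 then 0 else r (i - 1), fun i => ?_, ?_⟩
    · dsimp only
      split_ifs
      exacts [R.zero_mem, hr _]
    · rw [Finset.sum_range_succ', Finset.mul_sum]
      simp [pow_succ', mul_assoc]
  have Ps : ∀ n, ∀ x ∈ P (n + 1), ∃ r ∈ R, ∃ p ∈ P n, x = u ^ n * r + p := by
    rintro n _ ⟨r, hr, rfl⟩
    exact ⟨r n, hr n, _, ⟨r, hr, rfl⟩, by rw [Finset.sum_range_succ, add_comm]⟩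
  let L : Ideal S → ℕ → Ideal R := fun I n =>
    { carrier := {r | ∃ p ∈ P n, ∃ y ∈ I, (y : D) = u ^ n * r + p}
      zero_mem' := ⟨0, (P n).zero_mem, 0, I.zero_mem, by simp⟩
      add_mem' := by
        rintro a b ⟨p, hp, y, hy, e⟩ ⟨p', hp', y', hy', e'⟩
        refine ⟨p + p', (P n).add_mem hp hp', y + y', I.add_mem hy hy', ?_⟩
        push_cast
        rw [e, e', mul_add]
        abel
      smul_mem' := by
        rintro c a ⟨p, hp, y, hy, e⟩
        obtain ⟨c', hc', ec⟩ := h1' n c c.2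
        refine ⟨c' * p, PR n p hp c' hc', (⟨c', hRS hc'⟩ : S) * y, I.mul_mem_left _ hy, ?_⟩
        simp only [MulMemClass.coe_mul, smul_eq_mul, e, mul_add]
        rw [← mul_assoc, ec, mul_assoc] }
  have memL : ∀ I n r, r ∈ L I n ↔ ∃ p ∈ P n, ∃ y ∈ I, (y : D) = u ^ n * r + p :=
    fun I n r => Iff.rfl
  have Lmono1 : ∀ I J n, I ≤ J → L I n ≤ L J n := by
    rintro I J n h r ⟨p, hp, y, hy, e⟩
    exact ⟨p, hp, y, h hy, e⟩
  have Lmono2 : ∀ I, Monotone (L I) := by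
    intro I
    refine monotone_nat_of_le_succ ?_
    rintro n r ⟨p, hp, y, hy, e⟩
    refine ⟨u * p, Pu n p hp, (⟨u, huS⟩ : S) * y, I.mul_mem_left _ hy, ?_⟩
    simp only [MulMemClass.coe_mul, e, mul_add, pow_succ', mul_assoc]
  have Lle : ∀ I J : Ideal S, J ≤ I → (∀ n, L I n ≤ L J n) → I ≤ J := by
    intro I J hJI hL
    have aux : ∀ n, ∀ x ∈ I, (x : D) ∈ P n → x ∈ J := by
      intro n
      induction n with
      | zero =>
        rintro x hx ⟨r, hr, e⟩
        have : x = 0 := by ext; simpa using e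
        rw [this]; exact J.zero_mem
      | succ n ih =>
        intro x hx hxP
        obtain ⟨r, hr, p, hp, e⟩ := Ps n x hxP
        obtain ⟨p', hp', y, hy, e'⟩ := hL n (show (⟨r, hr⟩ : R) ∈ L I n from ⟨p, hp, x, hx, e⟩)
        have hxy : x - y ∈ J := by
          refine ih _ (I.sub_mem hx (hJI hy)) ?_
          have : ((x - y : S) : D) = p - p' := by
            push_cast
            rw [e, e']
            simp
          rw [this]
          exact (P n).sub_mem hp hp'
        simpa using J.add_mem hxy hy
    intro x hx
    obtain ⟨k, n, hP⟩ := hgen x x.2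
    have hm : (⟨u, huS⟩ : S) ^ k * x ∈ J :=
      aux n _ (I.mul_mem_left _ hx) (by rw [memP]; simpa using hP)
    have := J.mul_mem_left ((⟨u⁻¹, huS'⟩ : S) ^ k) hm
    convert this using 1
    ext
    simp [← mul_assoc, ← mul_pow, hu]
  rw [IsNoetherianRing, ← monotone_stabilizes_iff_noetherian]
  intro I
  have stab := monotone_stabilizes_iff_noetherian.2 hR
  obtain ⟨n0, hn0⟩ := stab ⟨fun n => L (I n) n, fun a b hab =>
    (Lmono1 _ _ a (I.monotone hab)).trans (Lmono2 _ hab)⟩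
  choose m hm using fun n => stab ⟨fun k => L (I k) n, fun a b hab =>
    (Lmono1 _ _ n (I.monotone hab))⟩
  replace hn0 : ∀ m, n0 ≤ m → L (I n0) n0 = L (I m) m := hn0
  replace hm : ∀ n k, m n ≤ k → L (I (m n)) n = L (I k) n := hm
  refine ⟨n0 + ∑ i ∈ Finset.range n0, m i, fun k hk => ?_⟩
  refine le_antisymm (I.monotone hk) (Lle _ _ (I.monotone hk) fun n => ?_)
  set N := n0 + ∑ i ∈ Finset.range n0, m i with hN
  rcases lt_or_ge n n0 with h | h
  · have hle : m n ≤ N := by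
      have := Finset.single_le_sum (f := m) (fun i _ => Nat.zero_le _) (Finset.mem_range.2 h)
      omega
    rw [← hm n N hle, ← hm n k (hle.trans hk)]
  · calc L (I k) n ≤ L (I (max k n)) (max k n) :=
          (Lmono1 _ _ _ (I.monotone (le_max_left _ _))).trans (Lmono2 _ (le_max_right _ _))
      _ = L (I n0) n0 := (hn0 _ (h.trans (le_max_right _ _))).symm
      _ ≤ L (I N) n := (Lmono1 _ _ _ (I.monotone (by omega))).trans (Lmono2 _ h)

structure EigGrading {K D Λ : Type*} [Field K] [DivisionRing D] [Algebra K D] [CommGroup Λ]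
    (W : Λ → Submodule K D) : Prop where
  one_mem : (1 : D) ∈ W 1
  mul_mem : ∀ a b x y, x ∈ W a → y ∈ W b → x * y ∈ W (a * b)
  inv_mem : ∀ a x, x ∈ W a → x⁻¹ ∈ W a⁻¹
  indep : iSupIndep W

section
variable {K D Λ : Type*} [Field K] [DivisionRing D] [Algebra K D] [CommGroup Λ]
    {W : Λ → Submodule K D}

def EigGrading.alg (hW : EigGrading W) (H : Subgroup Λ) : Subalgebra K D :=
  Submodule.toSubalgebra (⨆ χ : H, W χ)
    (Submodule.mem_iSup_of_mem (1 : H) hW.one_mem) (by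
      intro x y hx hy
      refine Submodule.iSup_induction _ (motive := fun x => x * y ∈ ⨆ χ : H, W χ) hx ?_ (by simp)
        (fun a b ha hb => by rw [add_mul]; exact add_mem ha hb)
      intro i x hx
      refine Submodule.iSup_induction _ (motive := fun y => x * y ∈ ⨆ χ : H, W χ) hy ?_ (by simp)
        (fun a b ha hb => by rw [mul_add]; exact add_mem ha hb)
      intro j y hy
      exact Submodule.mem_iSup_of_mem (i * j) (hW.mul_mem _ _ _ _ hx hy))

theorem EigGrading.mem_alg (hW : EigGrading W) (H : Subgroup Λ) (x : D) :
    x ∈ hW.alg H ↔ x ∈ ⨆ χ : H, W χ := Iff.rfl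

theorem EigGrading.mem_alg_of (hW : EigGrading W) (H : Subgroup Λ) {χ : Λ} (hχ : χ ∈ H) {x : D}
    (hx : x ∈ W χ) : x ∈ hW.alg H := Submodule.mem_iSup_of_mem (⟨χ, hχ⟩ : H) hx

theorem EigGrading.alg_mono (hW : EigGrading W) {H H' : Subgroup Λ} (h : H ≤ H') :
    hW.alg H ≤ hW.alg H' := by
  intro x hx
  exact (iSup_le fun i : H => fun y hy => hW.mem_alg_of H' (h i.2) hy :
    (⨆ χ : H, W χ) ≤ Subalgebra.toSubmodule (hW.alg H')) hx

theorem EigGrading.noeth_bot (hW : EigGrading W) : IsNoetherianRing (hW.alg ⊥) := by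
  have hmem : ∀ x ∈ hW.alg ⊥, x ∈ W 1 := by
    intro x hx
    refine (iSup_le fun i : (⊥ : Subgroup Λ) => ?_ : (⨆ χ : (⊥ : Subgroup Λ), W χ) ≤ W 1) hx
    rw [Subgroup.mem_bot.1 i.2]
  have hinv : ∀ x ∈ hW.alg ⊥, x⁻¹ ∈ hW.alg ⊥ := fun x hx =>
    hW.mem_alg_of ⊥ (χ := 1⁻¹) (by simp) (hW.inv_mem _ _ (hmem x hx))
  let E : Subfield D := { (hW.alg ⊥).toSubring with inv_mem' := hinv }
  let e : E ≃+* hW.alg ⊥ :=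
    { toFun := fun x => ⟨x.1, x.2⟩, invFun := fun x => ⟨x.1, x.2⟩
      left_inv := fun _ => rfl, right_inv := fun _ => rfl
      map_mul' := fun _ _ => rfl, map_add' := fun _ _ => rfl }
  exact isNoetherianRing_of_ringEquiv E e

theorem EigGrading.pow_mem (hW : EigGrading W) {χ : Λ} {u : D} (hu : u ∈ W χ) (n : ℕ) :
    u ^ n ∈ W (χ ^ n) := by
  induction n with
  | zero => simpa using hW.one_mem
  | succ n ih => rw [pow_succ, pow_succ]; exact hW.mul_mem _ _ _ _ ih hu

theorem EigGrading.zpow_mem (hW : EigGrading W) {χ : Λ} {u : D} (hu : u ∈ W χ) (n : ℤ) :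
    u ^ n ∈ W (χ ^ n) := by
  cases n with
  | ofNat n => simpa using hW.pow_mem hu n
  | negSucc n => simpa using hW.inv_mem _ _ (hW.pow_mem hu (n + 1))

theorem EigGrading.noeth_step (hW : EigGrading W) (H : Subgroup Λ)
    (hH : IsNoetherianRing (hW.alg H)) (χ : Λ) (u : D) (hu : u ≠ 0) (huχ : u ∈ W χ) :
    IsNoetherianRing (hW.alg (Subgroup.zpowers χ ⊔ H)) := by
  have hχ : χ ∈ Subgroup.zpowers χ ⊔ H := Subgroup.mem_sup_left (Subgroup.mem_zpowers χ)
  have conj : ∀ (a : Λ) (v : D), v ∈ W a → ∀ r ∈ hW.alg H, v * r * v⁻¹ ∈ hW.alg H := by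
    intro a v hv r hr
    refine Submodule.iSup_induction _ (motive := fun r => v * r * v⁻¹ ∈ hW.alg H) hr ?_
      (by simp [Subalgebra.zero_mem])
      (fun a b ha hb => by rw [mul_add, add_mul]; exact Subalgebra.add_mem _ ha hb)
    intro i x hx
    refine hW.mem_alg_of H (χ := a * i * a⁻¹) (by simp) ?_
    exact hW.mul_mem _ _ _ _ (hW.mul_mem _ _ _ _ hv hx) (hW.inv_mem _ _ hv)
  refine hilbert_aux (hW.alg H) _ (hW.alg_mono le_sup_right) u hu (hW.mem_alg_of _ hχ huχ)
    (hW.mem_alg_of _ (Subgroup.inv_mem _ hχ) (hW.inv_mem _ _ huχ)) (conj _ _ huχ)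
    (fun r hr => by simpa using conj _ _ (hW.inv_mem _ _ huχ) r hr) ?_
  have shift : ∀ (j n : ℕ) (r : ℕ → D), (∀ i, r i ∈ hW.alg H) →
      ∃ (m : ℕ) (r' : ℕ → D), (∀ i, r' i ∈ hW.alg H) ∧
        u ^ j * ∑ i ∈ Finset.range n, u ^ i * r i = ∑ i ∈ Finset.range m, u ^ i * r' i := by
    intro j n r hr
    refine ⟨j + n, fun i => if i < j then 0 else r (i - j), fun i => ?_, ?_⟩
    · dsimp only
      split_ifs
      exacts [Subalgebra.zero_mem _, hr _]
    · rw [Finset.sum_range_add, Finset.mul_sum, Finset.sum_eq_zero (s := Finset.range j), zero_add]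
      · exact Finset.sum_congr rfl fun i _ => by simp [pow_add, mul_assoc]
      · intro i hi
        simp [Finset.mem_range.1 hi]
  intro s hs
  refine Submodule.iSup_induction _ (motive := fun s => ∃ (k n : ℕ) (r : ℕ → D),
    (∀ i, r i ∈ hW.alg H) ∧ u ^ k * s = ∑ i ∈ Finset.range n, u ^ i * r i) hs ?_ ?_ ?_
  · rintro ⟨i, hi⟩ x hx
    obtain ⟨y, hy, h, hh, rfl⟩ := Subgroup.mem_sup.1 hi
    obtain ⟨z, rfl⟩ := Subgroup.mem_zpowers_iff.1 hy
    have hr : u ^ (-z) * x ∈ hW.alg H := by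
      refine hW.mem_alg_of H (χ := χ ^ (-z) * (χ ^ z * h)) (by simpa using hh) ?_
      exact hW.mul_mem _ _ _ _ (hW.zpow_mem huχ _) hx
    obtain ⟨m, r', h1, h2⟩ := shift (z + z.natAbs).toNat 1 (fun _ => u ^ (-z) * x) (fun _ => hr)
    refine ⟨z.natAbs, m, r', h1, ?_⟩
    rw [← h2]
    simp only [Finset.range_one, Finset.sum_singleton, pow_zero, one_mul]
    rw [← mul_assoc, ← zpow_natCast, ← zpow_natCast, ← zpow_add₀ hu]
    congr 2
    omega
  · exact ⟨0, 0, 0, fun _ => Subalgebra.zero_mem _, by simp⟩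
  · rintro x y ⟨k, n, r, hr, e⟩ ⟨k', n', r', hr', e'⟩
    obtain ⟨m, q, hq, f⟩ := shift k' n r hr
    obtain ⟨m', q', hq', f'⟩ := shift k n' r' hr'
    refine ⟨k + k', m + m', fun i => (if i < m then q i else 0) + (if i < m' then q' i else 0),
      fun i => ?_, ?_⟩
    · refine Subalgebra.add_mem _ ?_ ?_ <;> split_ifs
      exacts [hq _, Subalgebra.zero_mem _, hq' _, Subalgebra.zero_mem _]
    · have A : u ^ (k + k') * x = ∑ i ∈ Finset.range m, u ^ i * q i := by
        rw [add_comm, pow_add, mul_assoc, e, f]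
      have B : u ^ (k + k') * y = ∑ i ∈ Finset.range m', u ^ i * q' i := by
        rw [pow_add, mul_assoc, e', f']
      have ext : ∀ (a b : ℕ) (q : ℕ → D), a ≤ b → ∑ i ∈ Finset.range b,
          u ^ i * (if i < a then q i else 0) = ∑ i ∈ Finset.range a, u ^ i * q i := by
        intro a b q hab
        rw [← Finset.sum_subset (Finset.range_mono hab)]
        · exact Finset.sum_congr rfl fun i hi => by simp [Finset.mem_range.1 hi]
        · intro i _ hi
          rw [if_neg (by simpa using hi), mul_zero]
      simp only [mul_add, Finset.sum_add_distrib]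
      rw [A, B, ext m _ q (by omega), ext m' _ q' (by omega)]

theorem EigGrading.noeth_finset (hW : EigGrading W) (T : Finset Λ)
    (hT : ∀ χ ∈ T, ∃ u ∈ W χ, u ≠ 0) :
    IsNoetherianRing (hW.alg (Subgroup.closure (T : Set Λ))) := by
  classical
  induction T using Finset.induction_on with
  | empty =>
    rw [Finset.coe_empty, Subgroup.closure_empty]
    exact hW.noeth_bot
  | insert χ T _ ih =>
    obtain ⟨u, hu, hu0⟩ := hT χ (by simp)
    rw [Finset.coe_insert, Set.insert_eq, Subgroup.closure_union,
      ← Subgroup.zpowers_eq_closure]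
    exact hW.noeth_step _ (ih fun χ hχ => hT χ (by simp [hχ])) χ u hu0 hu

/-- division ring of left fractions of a Noetherian subalgebra -/
def fracSub (S : Subalgebra K D) [IsNoetherianRing S] : Subfield D where
  carrier := {x | ∃ a ∈ S, a ≠ 0 ∧ a * x ∈ S}
  one_mem' := ⟨1, S.one_mem, one_ne_zero, by simp [S.one_mem]⟩
  zero_mem' := ⟨1, S.one_mem, one_ne_zero, by simp [S.zero_mem]⟩
  neg_mem' := by
    rintro x ⟨a, ha, h0, h⟩
    exact ⟨a, ha, h0, by simpa using h⟩
  add_mem' := by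
    rintro x y ⟨a, ha, h0, h⟩ ⟨b, hb, h0', h'⟩
    obtain ⟨c, d, hd, e⟩ := ore_aux (⟨b, hb⟩ : S) ⟨a, ha⟩ (fun h => h0' (congrArg Subtype.val h))
    have e' : (d : D) * a = c * b := congrArg Subtype.val e
    refine ⟨d * a, S.mul_mem d.2 ha, mul_ne_zero (by simpa using hd) h0, ?_⟩
    rw [mul_add]
    refine S.add_mem ?_ ?_
    · rw [mul_assoc]; exact S.mul_mem d.2 h
    · rw [e', mul_assoc]; exact S.mul_mem c.2 h'
  mul_mem' := by
    rintro x y ⟨a, ha, h0, h⟩ ⟨b, hb, h0', h'⟩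
    obtain ⟨c, d, hd, e⟩ := ore_aux (⟨b, hb⟩ : S) ⟨a * x, h⟩ (fun h => h0' (congrArg Subtype.val h))
    have e' : (d : D) * (a * x) = c * b := congrArg Subtype.val e
    refine ⟨d * a, S.mul_mem d.2 ha, mul_ne_zero (by simpa using hd) h0, ?_⟩
    have : (d : D) * a * (x * y) = c * (b * y) := by
      rw [← mul_assoc, mul_assoc (d : D), e', mul_assoc]
    rw [this]
    exact S.mul_mem c.2 h'
  inv_mem' := by
    rintro x ⟨a, ha, h0, h⟩
    rcases eq_or_ne x 0 with rfl | hx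
    · exact ⟨a, ha, h0, by simp [S.zero_mem]⟩
    · exact ⟨a * x, h, mul_ne_zero h0 hx, by simpa [mul_assoc, hx] using ha⟩

theorem mem_fracSub (S : Subalgebra K D) [IsNoetherianRing S] (x : D) :
    x ∈ fracSub S ↔ ∃ a ∈ S, a ≠ 0 ∧ a * x ∈ S := Iff.rfl

theorem exists_functional (S : Subalgebra K D) [IsNoetherianRing S] (u : D)
    (hu : ∀ a ∈ S, a * u ∈ S → a = 0) :
    ∃ f : D →ₗ[K] D, (∀ a ∈ S, ∀ x, f (a * x) = a * f x) ∧ f 1 = 0 ∧ f u ≠ 0 := by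
  have hS : ∀ a ∈ S, a ∈ fracSub S := fun a ha =>
    ⟨1, S.one_mem, one_ne_zero, by simpa using ha⟩
  have hnot : u ∉ Submodule.span (fracSub S) {(1 : D)} := by
    intro h
    obtain ⟨e, he⟩ := Submodule.mem_span_singleton.1 h
    obtain ⟨a, ha, h0, h'⟩ := e.2
    refine h0 (hu a ha ?_)
    rw [← he, Subfield.smul_def, smul_eq_mul, mul_one]
    exact h'
  obtain ⟨f, hf, hle⟩ := Submodule.exists_le_ker_of_notMem hnot
  have hmul : ∀ a ∈ S, ∀ x, (f (a * x) : D) = a * f x := by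
    intro a ha x
    have := congrArg Subtype.val (f.map_smul ⟨a, hS a ha⟩ x)
    simpa [Subfield.smul_def] using this
  refine ⟨{ toFun := fun x => (f x : D), map_add' := fun x y => by simp, map_smul' := ?_ },
    hmul, ?_, ?_⟩
  · intro k x
    simp only [RingHom.id_apply, Algebra.smul_def]
    exact hmul _ (S.algebraMap_mem k) x
  · have : f 1 = 0 := hle (Submodule.mem_span_singleton_self 1)
    simp [this]
  · simpa using hf

def commIdeal (S : Subalgebra K D) : Ideal (D ⊗[K] Dᵐᵒᵖ) :=
  Ideal.span {z | ∃ a ∈ S, z = a ⊗ₜ[K] 1 - 1 ⊗ₜ[K] MulOpposite.op a}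

theorem not_mem_commIdeal (S : Subalgebra K D) [IsNoetherianRing S] (u : D)
    (hu : ∀ a ∈ S, a * u ∈ S → a = 0) :
    u ⊗ₜ[K] 1 - 1 ⊗ₜ[K] MulOpposite.op u ∉ commIdeal S := by
  obtain ⟨f, hf, hf1, hfu⟩ := exists_functional S u hu
  let ψ : D ⊗[K] Dᵐᵒᵖ →ₗ[K] D := TensorProduct.lift
    ((LinearMap.mul K D).compl₂ (f ∘ₗ (MulOpposite.opLinearEquiv K).symm.toLinearMap))
  have hψ : ∀ a b, ψ (a ⊗ₜ b) = a * f b.unop := fun a b => by simp [ψ]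
  intro hmem
  have key : ∀ z ∈ commIdeal S, ∀ c, ψ (c * z) = 0 := by
    intro z hz
    refine Submodule.span_induction (p := fun z _ => ∀ c, ψ (c * z) = 0) ?_ (by simp) ?_ ?_ hz
    · rintro _ ⟨a, ha, rfl⟩ c
      induction c using TensorProduct.induction_on with
      | zero => simp
      | add x y hx hy => rw [add_mul, map_add, hx, hy, add_zero]
      | tmul c d =>
        simp [mul_sub, hψ, hf a ha, mul_assoc]
    · intro x y _ _ hx hy c
      rw [mul_add, map_add, hx, hy, add_zero]
    · intro a x _ hx c
      rw [smul_eq_mul, ← mul_assoc, hx]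
  have := key _ hmem 1
  rw [one_mul, map_sub, hψ, hψ] at this
  simp [hf1] at this
  exact hfu this

theorem EigGrading.noeth_top (hW : EigGrading W) (hN : IsNoetherianRing (D ⊗[K] Dᵐᵒᵖ)) :
    IsNoetherianRing (hW.alg ⊤) := by
  classical
  let A : Set (Ideal (D ⊗[K] Dᵐᵒᵖ)) := {I | ∃ T : Finset Λ, (∀ χ ∈ T, ∃ u ∈ W χ, u ≠ 0) ∧
    I = commIdeal (hW.alg (Subgroup.closure (T : Set Λ)))}
  obtain ⟨I, ⟨T, hT, rfl⟩, hmax⟩ := set_has_maximal_iff_noetherian.2 hN A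
    ⟨_, ∅, by simp, rfl⟩
  have hTn := hW.noeth_finset T hT
  have hall : ∀ χ, (∃ u ∈ W χ, u ≠ 0) → χ ∈ Subgroup.closure (T : Set Λ) := by
    rintro χ ⟨u, hu, hu0⟩
    by_contra hχ
    refine hmax (commIdeal (hW.alg (Subgroup.closure ((insert χ T : Finset Λ) : Set Λ))))
      ⟨insert χ T, ?_, rfl⟩ ?_
    · intro a ha
      rcases Finset.mem_insert.1 ha with rfl | ha
      exacts [⟨u, hu, hu0⟩, hT a ha]
    · refine lt_of_le_of_ne (Ideal.span_mono ?_) ?_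
      · rintro _ ⟨a, ha, rfl⟩
        exact ⟨a, hW.alg_mono (Subgroup.closure_mono (by simp)) ha, rfl⟩
      · intro heq
        refine not_mem_commIdeal (hW.alg (Subgroup.closure (T : Set Λ))) u ?_ ?_
        · intro a ha hau
          set H := Subgroup.closure (T : Set Λ)
          have hdis : Disjoint (H : Set Λ) ((fun x => x * χ) '' (H : Set Λ)) := by
            rw [Set.disjoint_left]
            rintro _ hx ⟨y, hy, rfl⟩
            exact hχ ((Subgroup.mul_mem_cancel_left H hy).1 hx)
          have hd := hW.indep.disjoint_biSup_biSup hdis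
          have h1 : a * u ∈ ⨆ i ∈ (H : Set Λ), W i := by
            rw [iSup_subtype']; exact hau
          have h2 : a * u ∈ ⨆ i ∈ (fun x => x * χ) '' (H : Set Λ), W i := by
            refine Submodule.iSup_induction _ (motive := fun a => a * u ∈
              ⨆ i ∈ (fun x => x * χ) '' (H : Set Λ), W i) ha ?_ (by simp)
              (fun a b ha hb => by rw [add_mul]; exact add_mem ha hb)
            intro i x hx
            exact Submodule.mem_iSup_of_mem (i * χ : Λ) (Submodule.mem_iSup_of_mem
              ⟨i, i.2, rfl⟩ (hW.mul_mem _ _ _ _ hx hu))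
          exact (mul_eq_zero.1 (Submodule.disjoint_def.1 hd _ h1 h2)).resolve_right hu0
        · rw [heq]
          exact Ideal.subset_span ⟨u, hW.mem_alg_of _ (Subgroup.subset_closure (by simp)) hu, rfl⟩
  have : hW.alg ⊤ = hW.alg (Subgroup.closure (T : Set Λ)) := by
    refine le_antisymm ?_ (hW.alg_mono le_top)
    intro x hx
    refine (iSup_le fun i : (⊤ : Subgroup Λ) => fun y hy => ?_ : (⨆ χ : (⊤ : Subgroup Λ), W χ) ≤
      Subalgebra.toSubmodule (hW.alg (Subgroup.closure (T : Set Λ)))) hx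
    rcases eq_or_ne y 0 with rfl | hy0
    · exact Submodule.zero_mem _
    · exact hW.mem_alg_of _ (hall i ⟨y, hy, hy0⟩) hy
  rw [this]
  exact hTn

theorem EigGrading.op (hW : EigGrading W) :
    EigGrading (fun χ => (W χ).map (MulOpposite.opLinearEquiv K).toLinearMap) where
  one_mem := ⟨1, hW.one_mem, rfl⟩
  mul_mem := by
    rintro a b _ _ ⟨x, hx, rfl⟩ ⟨y, hy, rfl⟩
    refine ⟨y * x, ?_, rfl⟩
    rw [mul_comm]
    exact hW.mul_mem _ _ _ _ hy hx
  inv_mem := by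
    rintro a _ ⟨x, hx, rfl⟩
    exact ⟨x⁻¹, hW.inv_mem _ _ hx, rfl⟩
  indep := hW.indep.map_orderIso
    (Submodule.orderIsoMapComap (MulOpposite.opLinearEquiv K : D ≃ₗ[K] Dᵐᵒᵖ))

theorem EigGrading.noeth_op (hW : EigGrading W) (hN : IsNoetherianRing (D ⊗[K] Dᵐᵒᵖ)) :
    IsNoetherianRing (hW.alg ⊤)ᵐᵒᵖ := by
  have hN' : IsNoetherianRing (Dᵐᵒᵖ ⊗[K] Dᵐᵒᵖᵐᵒᵖ) :=
    isNoetherianRing_of_ringEquiv _ ((Algebra.TensorProduct.comm K D Dᵐᵒᵖ).trans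
      (Algebra.TensorProduct.congr AlgEquiv.refl (AlgEquiv.opOp K D))).toRingEquiv
  have h := hW.op.noeth_top hN'
  have hmem : ∀ x : D, MulOpposite.op x ∈ hW.op.alg ⊤ ↔ x ∈ hW.alg ⊤ := by
    intro x
    rw [EigGrading.mem_alg, EigGrading.mem_alg, ← Submodule.map_iSup]
    constructor
    · rintro ⟨y, hy, e⟩
      have : y = x := MulOpposite.op_injective e
      exact this ▸ hy
    · intro hx
      exact ⟨x, hx, rfl⟩
  let e : hW.op.alg ⊤ ≃+* (hW.alg ⊤)ᵐᵒᵖ :=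
    { toFun := fun x => MulOpposite.op ⟨x.1.unop, (hmem _).1 x.2⟩
      invFun := fun x => ⟨MulOpposite.op x.unop.1, (hmem _).2 x.unop.2⟩
      left_inv := fun _ => rfl, right_inv := fun _ => rfl
      map_mul' := fun _ _ => rfl, map_add' := fun _ _ => rfl }
  exact isNoetherianRing_of_ringEquiv _ e

end

theorem eigGrading_of {K D : Type*} [Field K] [DivisionRing D] [Algebra K D]
    (t : ℕ) (σ : Fin t → (D ≃ₐ[K] D))
    (hcomm : ∀ i j, ∀ x : D, σ i (σ j x) = σ j (σ i x)) :
    EigGrading (fun χ : Fin t → Kˣ =>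
      ⨅ i, Module.End.eigenspace ((σ i).toLinearMap : Module.End K D) (χ i : K)) where
  one_mem := by simp [Submodule.mem_iInf, Module.End.mem_eigenspace_iff]
  mul_mem := by
    intro a b x y hx hy
    simp only [Submodule.mem_iInf, Module.End.mem_eigenspace_iff, AlgEquiv.toLinearMap_apply]
      at hx hy ⊢
    intro i
    rw [map_mul, hx, hy, Pi.mul_apply, Units.val_mul, smul_mul_smul_comm]
  inv_mem := by
    intro a x hx
    simp only [Submodule.mem_iInf, Module.End.mem_eigenspace_iff, AlgEquiv.toLinearMap_apply]
      at hx ⊢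
    intro i
    rw [map_inv₀, hx]
    rcases eq_or_ne x 0 with rfl | hx0
    · simp
    · refine inv_eq_of_mul_eq_one_right ?_
      rw [smul_mul_smul_comm]
      simp [hx0]
  indep := by
    have h := Module.End.independent_iInf_maxGenEigenspace_of_forall_mapsTo
      (fun i => ((σ i).toLinearMap : Module.End K D)) (fun i j φ =>
        Module.End.mapsTo_maxGenEigenspace_of_comm (by
          ext x
          exact hcomm j i x) φ)
    have h2 := h.comp (f := fun (χ : Fin t → Kˣ) (i : Fin t) => (χ i : K)) (by
      intro a b hab
      funext i
      exact Units.ext (congrFun hab i))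
    refine h2.mono fun χ => iInf_mono fun i => ?_
    exact Module.End.eigenspace_le_maxGenEigenspace

/-- Let `D` be a division `K`-algebra with `D ⊗[K] Dᵐᵒᵖ` Noetherian and let
`σ₁, …, σ_t` be pairwise commuting `K`-algebra automorphisms of `D`.  The `K`-linear span
`D(Δ)` of all common eigenvectors of the `σᵢ` is a `K`-subalgebra of `D` which is a domain
and a left and right Noetherian ring. -/
theorem stmt5 (K D : Type*) [Field K] [DivisionRing D] [Algebra K D]
    (hNoeth : IsNoetherianRing (D ⊗[K] Dᵐᵒᵖ))
    (t : ℕ) (σ : Fin t → (D ≃ₐ[K] D))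
    (hcomm : ∀ i j, ∀ x : D, σ i (σ j x) = σ j (σ i x)) :
    ∃ S : Subalgebra K D,
      (S : Set D) =
        (Submodule.span K
          {u : D | ∃ lam : Fin t → Kˣ, ∀ i, σ i u = (lam i : K) • u} : Set D) ∧
      IsDomain S ∧ IsNoetherianRing S ∧ IsNoetherianRing Sᵐᵒᵖ := by
  have hW := eigGrading_of t σ hcomm
  refine ⟨hW.alg ⊤, ?_, inferInstance, hW.noeth_top hNoeth, hW.noeth_op hNoeth⟩
  have : (⨆ χ : (⊤ : Subgroup (Fin t → Kˣ)),
      ⨅ i, Module.End.eigenspace ((σ i).toLinearMap : Module.End K D) (χ.1 i : K)) =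
      Submodule.span K {u : D | ∃ lam : Fin t → Kˣ, ∀ i, σ i u = (lam i : K) • u} := by
    apply le_antisymm
    · refine iSup_le fun χ => fun x hx => Submodule.subset_span ⟨χ.1, fun i => ?_⟩
      simp only [Submodule.mem_iInf, Module.End.mem_eigenspace_iff,
        AlgEquiv.toLinearMap_apply] at hx
      exact hx i
    · refine Submodule.span_le.2 ?_
      rintro u ⟨lam, h⟩
      refine Submodule.mem_iSup_of_mem (⟨lam, Subgroup.mem_top _⟩ : (⊤ : Subgroup (Fin t → Kˣ))) ?_
      simp only [Submodule.mem_iInf, Module.End.mem_eigenspace_iff, AlgEquiv.toLinearMap_apply]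
      exact h
  rw [← this]
  rfl
end

section
/- Let K be a field and A a commutative integral domain which is a finitely generated K-algebra, and let δ₁, …, δ_t be pairwise commuting K-derivations of A. Let Ev(Δ, A) := { λ ∈ K^t : there exists a ∈ A, a ≠ 0, with δᵢ(a) = λᵢ·a for all i }. Then the subgroup of (K^t, +) generated by Ev(Δ, A) is a finitely generated abelian group; in particular, Ev(Δ, A) is a submonoid of a finitely generated abelian group and its subgroup of torsion elements is finite. -/
open TensorProduct in
theorem mem_of_tmul_comm {M F : Type*} [Field M] [Field F] [Algebra M F] (x : F)
    (h : x ⊗ₜ[M] (1 : F) = (1 : F) ⊗ₜ[M] x) : x ∈ Submodule.span M {(1 : F)} := by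
  by_contra hx
  obtain ⟨f, hf, hf'⟩ := Submodule.exists_dual_map_eq_bot_of_notMem hx inferInstance
  have h1 : f 1 = 0 := by
    have : f 1 ∈ (Submodule.span M {(1 : F)}).map f :=
      Submodule.mem_map_of_mem (Submodule.mem_span_singleton_self _)
    rw [hf'] at this
    simpa using this
  have h2 := congrArg (TensorProduct.lift ((LinearMap.lsmul M F).comp f)) h
  simp [h1] at h2
  exact hf h2

section
variable {K A : Type*} [Field K] [CommRing A] [Algebra K A] {t : ℕ}
  (δ : Fin t → Derivation K A A)

def evW (lam : Fin t → K) : Submodule K A :=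
  ⨅ i, Module.End.eigenspace (δ i : A →ₗ[K] A) (lam i)

theorem mem_evW {lam : Fin t → K} {a : A} : a ∈ evW δ lam ↔ ∀ i, δ i a = lam i • a := by
  simp [evW, Submodule.mem_iInf, Module.End.mem_eigenspace_iff]

theorem evW_mul {l m : Fin t → K} {a b : A} (ha : a ∈ evW δ l) (hb : b ∈ evW δ m) :
    a * b ∈ evW δ (l + m) := by
  rw [mem_evW] at *
  intro i
  rw [Derivation.leibniz, ha, hb]
  simp only [smul_eq_mul, Pi.add_apply, add_smul, mul_smul_comm]
  rw [mul_comm b a, add_comm]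

theorem evW_one : (1 : A) ∈ evW δ 0 := by
  rw [mem_evW]; intro i; simp

def evV (S : Set (Fin t → K)) : Submodule K A := ⨆ h ∈ S, evW δ h

theorem evW_le_evV {S : Set (Fin t → K)} {h} (hh : h ∈ S) : evW δ h ≤ evV δ S :=
  le_biSup (evW δ) hh

theorem evV_mul_left {S S' : Set (Fin t → K)} {g : Fin t → K} (hS : ∀ h ∈ S, g + h ∈ S')
    {x a : A} (hx : x ∈ evW δ g) (ha : a ∈ evV δ S) : x * a ∈ evV δ S' := by
  have : evV δ S ≤ (evV δ S').comap (LinearMap.mulLeft K x) := by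
    refine iSup₂_le fun h hh a ha => ?_
    exact evW_le_evV δ (hS h hh) (evW_mul δ hx ha)
  exact this ha

theorem evV_mul (H : AddSubgroup (Fin t → K)) {x a : A} (hx : x ∈ evV δ (H : Set (Fin t → K)))
    (ha : a ∈ evV δ (H : Set (Fin t → K))) : x * a ∈ evV δ (H : Set (Fin t → K)) := by
  have : evV δ (H : Set (Fin t → K)) ≤
      (evV δ (H : Set (Fin t → K))).comap (LinearMap.mulRight K a) := by
    refine iSup₂_le fun h hh x hx => ?_
    exact evV_mul_left δ (fun k hk => H.add_mem hh hk) hx ha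
  exact this hx

theorem evV_adjoin (H : AddSubgroup (Fin t → K)) (T : Set A)
    (hT : T ⊆ evV δ (H : Set (Fin t → K))) {x : A} (hx : x ∈ Algebra.adjoin K T) :
    x ∈ evV δ (H : Set (Fin t → K)) := by
  have h1 : (1 : A) ∈ evV δ (H : Set (Fin t → K)) := evW_le_evV δ H.zero_mem (evW_one δ)
  induction hx using Algebra.adjoin_induction with
  | mem x hx => exact hT hx
  | algebraMap r => rw [Algebra.algebraMap_eq_smul_one]; exact Submodule.smul_mem _ _ h1
  | add x y _ _ hx hy => exact add_mem hx hy
  | mul x y _ _ hx hy => exact evV_mul δ H hx hy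

theorem evW_indep [IsDomain A] (hcomm : ∀ i j, ∀ x : A, δ i (δ j x) = δ j (δ i x)) :
    iSupIndep (evW δ) := by
  refine iSupIndep.mono (Module.End.independent_iInf_maxGenEigenspace_of_forall_mapsTo
    (fun i => (δ i : A →ₗ[K] A)) ?_) ?_
  · intro i j φ
    exact Module.End.mapsTo_maxGenEigenspace_of_comm
      (LinearMap.ext fun x => hcomm j i x) φ
  · intro l
    exact iInf_mono fun i => Module.End.genEigenspace_le_maximal _ _ _

theorem weight_mem [IsDomain A] (hcomm : ∀ i j, ∀ x : A, δ i (δ j x) = δ j (δ i x))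
    (H : AddSubgroup (Fin t → K)) {g : Fin t → K} {x a b : A} (hx : x ∈ evW δ g) (hx0 : x ≠ 0)
    (ha : a ∈ evV δ (H : Set (Fin t → K))) (hb : b ∈ evV δ (H : Set (Fin t → K)))
    (hb0 : b ≠ 0) (h : x * b = a) : g ∈ H := by
  by_contra hg
  have hd := (evW_indep δ hcomm).disjoint_biSup_biSup
    (s := (H : Set (Fin t → K))) (t := {l | ∃ h ∈ H, l = g + h}) (by
      rw [Set.disjoint_left]
      rintro l hl ⟨h, hh, rfl⟩
      exact hg ((H.add_mem_cancel_right hh).1 hl))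
  have h2 : a ∈ evV δ {l | ∃ h ∈ H, l = g + h} := by
    rw [← h]
    refine evV_mul_left δ (S := (H : Set (Fin t → K))) ?_ hx hb
    exact fun k hk => ⟨k, hk, rfl⟩
  have := Submodule.disjoint_def.1 hd a ha h2
  rw [← h] at this
  exact mul_ne_zero hx0 hb0 this

open TensorProduct in
theorem fg_closure [IsDomain A] (hfg : Algebra.FiniteType K A)
    (hcomm : ∀ i j, ∀ x : A, δ i (δ j x) = δ j (δ i x)) :
    (AddSubgroup.closure
      {lam : Fin t → K | ∃ a : A, a ≠ 0 ∧ ∀ i, δ i a = lam i • a}).FG := by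
  classical
  have : IsNoetherianRing A := Algebra.FiniteType.isNoetherianRing K A
  have : IsNoetherianRing (A ⊗[K] A) := Algebra.FiniteType.isNoetherianRing A (A ⊗[K] A)
  let T : Set A := {a | a ≠ 0 ∧ ∃ l, a ∈ evW δ l}
  let d : A → A ⊗[K] A := fun a => a ⊗ₜ 1 - 1 ⊗ₜ a
  obtain ⟨s, hsT, hs⟩ := (Submodule.fg_span_iff_fg_span_finset_subset (R := A ⊗[K] A)
    (d '' T)).1 (IsNoetherian.noetherian _)
  obtain ⟨T0, hT0, rfl⟩ := Finset.subset_set_image_iff.1 hsT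
  have hw : ∀ a : A, ∃ l, a ∈ T → a ∈ evW δ l := fun a => by
    by_cases ha : a ∈ T
    · obtain ⟨l, hl⟩ := ha.2
      exact ⟨l, fun _ => hl⟩
    · exact ⟨0, fun h => absurd h ha⟩
  choose w hw using hw
  let H := AddSubgroup.closure ((T0.image w : Finset (Fin t → K)) : Set (Fin t → K))
  have hTH : (T0 : Set A) ⊆ evV δ (H : Set (Fin t → K)) := fun a ha =>
    evW_le_evV δ (AddSubgroup.subset_closure (by simpa using ⟨a, ha, rfl⟩)) (hw a (hT0 ha))
  refine ⟨T0.image w, le_antisymm ?_ ?_⟩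
  · rw [AddSubgroup.closure_le]
    intro l hl
    obtain ⟨a, ha, rfl⟩ := Finset.mem_image.1 (Finset.mem_coe.1 hl)
    exact AddSubgroup.subset_closure ⟨a, (hT0 ha).1, (mem_evW δ).1 (hw a (hT0 ha))⟩
  rw [AddSubgroup.closure_le]
  rintro l ⟨x, hx0, hx⟩
  rw [← mem_evW] at hx
  let F := FractionRing A
  let ι : A →ₐ[K] F := IsScalarTower.toAlgHom K A F
  have hι : Function.Injective ι := IsFractionRing.injective A F
  let M := IntermediateField.adjoin K (ι '' (T0 : Set A))
  let Φ : A ⊗[K] A →ₐ[K] F ⊗[M] F := Algebra.TensorProduct.productMap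
    (((Algebra.TensorProduct.includeLeft : F →ₐ[M] F ⊗[M] F).restrictScalars K).comp ι)
    (((Algebra.TensorProduct.includeRight : F →ₐ[M] F ⊗[M] F).restrictScalars K).comp ι)
  have hΦ : ∀ a, Φ (d a) = ι a ⊗ₜ 1 - 1 ⊗ₜ ι a := fun a => by
    simp [Φ, d]
  have hker : Submodule.span (A ⊗[K] A) (d '' T) ≤ RingHom.ker Φ := by
    rw [hs, Submodule.span_le]
    intro y hy
    obtain ⟨a, ha, rfl⟩ := Finset.mem_image.1 (Finset.mem_coe.1 hy)
    have hm : ι a ∈ M := IntermediateField.subset_adjoin K _ ⟨a, ha, rfl⟩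
    change Φ (d a) = 0
    rw [hΦ, sub_eq_zero]
    have : ι a = (⟨ι a, hm⟩ : M) • (1 : F) := by
      rw [Algebra.smul_def, mul_one]; rfl
    rw [this, TensorProduct.smul_tmul]
  have hxk : Φ (d x) = 0 := hker (Submodule.subset_span ⟨x, ⟨hx0, l, hx⟩, rfl⟩)
  rw [hΦ, sub_eq_zero] at hxk
  obtain ⟨m, hm⟩ := Submodule.mem_span_singleton.1 (mem_of_tmul_comm _ hxk)
  have hxM : ι x ∈ M := by
    rw [← hm, Algebra.smul_def, mul_one]; exact m.2
  obtain ⟨r, hr, q, hq, hrq⟩ := IntermediateField.mem_adjoin_iff_div.1 hxM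
  rw [← AlgHom.map_adjoin] at hr hq
  obtain ⟨r, hr, rfl⟩ := hr
  obtain ⟨q, hq, rfl⟩ := hq
  have hx0' : ι x ≠ 0 := fun h => hx0 (hι (by simpa using h))
  have hq0 : ι q ≠ 0 := by
    intro h
    apply hx0'
    rw [hrq]
    change ι r / ι q = 0
    rw [h, div_zero]
  have hxq : x * q = r := by
    apply hι
    rw [map_mul, hrq]
    exact div_mul_cancel₀ _ hq0
  exact weight_mem δ hcomm H hx hx0 (evV_adjoin δ H _ hTH hr) (evV_adjoin δ H _ hTH hq)
    (fun h => hq0 (by simp [h])) hxq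
end


/-- Let `A` be a commutative domain which is a finitely generated `K`-algebra
and `δ₁, …, δ_t` pairwise commuting `K`-derivations of `A`.  Then the subgroup of `(K^t, +)`
generated by the monoid `Ev(Δ, A)` of common eigenvalues is finitely generated, and the set of
torsion elements of `Ev(Δ, A)` is finite. -/
theorem stmt9 (K A : Type*) [Field K] [CommRing A] [IsDomain A] [Algebra K A]
    (hfg : Algebra.FiniteType K A)
    (t : ℕ) (δ : Fin t → Derivation K A A)
    (hcomm : ∀ i j, ∀ x : A, δ i (δ j x) = δ j (δ i x)) :
    (AddSubgroup.closure
      {lam : Fin t → K | ∃ a : A, a ≠ 0 ∧ ∀ i, δ i a = lam i • a}).FG ∧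
    Set.Finite {lam : Fin t → K |
      (∃ a : A, a ≠ 0 ∧ ∀ i, δ i a = lam i • a) ∧ ∃ n : ℕ, 0 < n ∧ n • lam = 0} := by
  have hF := fg_closure δ hfg hcomm
  refine ⟨hF, ?_⟩
  obtain ⟨p, hp⟩ := CharP.exists K
  rcases Nat.eq_zero_or_pos p with rfl | hp0
  · have : CharZero K := CharP.charP_to_charZero K
    refine (Set.finite_singleton 0).subset ?_
    rintro l ⟨-, n, hn, h⟩
    ext i
    have := congrFun h i
    simp at this
    rcases this with h | h
    · omega
    · simpa using h
  · have := (AddGroup.fg_iff_addSubgroup_fg _).2 hF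
    have hfin := AddCommGroup.finite_of_fg_isAddTorsion (AddSubgroup.closure
      {lam : Fin t → K | ∃ a : A, a ≠ 0 ∧ ∀ i, δ i a = lam i • a}) (by
        intro x
        rw [isOfFinAddOrder_iff_nsmul_eq_zero]
        refine ⟨p, hp0, ?_⟩
        ext i
        simp)
    refine (Set.toFinite (AddSubgroup.closure
      {lam : Fin t → K | ∃ a : A, a ≠ 0 ∧ ∀ i, δ i a = lam i • a} : Set (Fin t → K))).subset ?_
    rintro l ⟨h, -⟩
    exact AddSubgroup.subset_closure h
end

section
/- Let K be a field and A a commutative integral domain which is a finitely generated K-algebra, and let σ₁, …, σ_t be pairwise commuting K-algebra automorphisms of A. Let Ev(Δ, A) := { λ ∈ (K^×)^t : there exists a ∈ A, a ≠ 0, with σᵢ(a) = λᵢ·a for all i }. Then the subgroup of the multiplicative group (K^×)^t generated by Ev(Δ, A) is a finitely generated abelian group; in particular, Ev(Δ, A) is a submonoid of a finitely generated abelian group and its subgroup of torsion elements is finite. -/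
open TensorProduct in
lemma aux_descent (M L : Type*) [Field M] [Field L] [Algebra M L] (f : L)
    (h : f ⊗ₜ[M] (1 : L) = (1 : L) ⊗ₜ[M] f) : ∃ c : M, algebraMap M L c = f := by
  by_contra hcon
  have hn : f ∉ (Submodule.span M {(1 : L)}) := by
    intro h
    obtain ⟨c, hc⟩ := Submodule.mem_span_singleton.1 h
    exact hcon ⟨c, by rw [← hc, Algebra.smul_def, mul_one]⟩
  obtain ⟨φ, h1, h2⟩ := Submodule.exists_le_ker_of_notMem hn
  have h3 : φ 1 = 0 := h2 (Submodule.mem_span_singleton_self _)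
  have h5 := congrArg (fun z => TensorProduct.lid M L (TensorProduct.map φ LinearMap.id z)) h
  simp [h3, Algebra.smul_def] at h5
  exact h1 h5

open TensorProduct in
/-- If a family of elements of `A` is given, finitely many of them generate the same field. -/
lemma aux_fin (K A : Type*) [Field K] [CommRing A] [IsDomain A] [Algebra K A]
    (hfg : Algebra.FiniteType K A) (S : Set A) :
    ∃ T : Finset A, (T : Set A) ⊆ S ∧ ∀ f ∈ S, ∃ a ∈ Algebra.adjoin K (T : Set A),
      ∃ b ∈ Algebra.adjoin K (T : Set A), b ≠ 0 ∧ f * b = a := by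
  classical
  have : IsNoetherianRing A := Algebra.FiniteType.isNoetherianRing K A
  have : IsNoetherianRing (A ⊗[K] A) := Algebra.FiniteType.isNoetherianRing A (A ⊗[K] A)
  let d : A → A ⊗[K] A := fun f => f ⊗ₜ 1 - 1 ⊗ₜ f
  obtain ⟨s', hs', hspan⟩ := (Submodule.fg_span_iff_fg_span_finset_subset (R := A ⊗[K] A)
    (d '' S)).1 (IsNoetherian.noetherian _)
  obtain ⟨T, hTS, rfl⟩ := Finset.subset_set_image_iff.1 hs'
  refine ⟨T, hTS, fun f hf => ?_⟩
  let L := FractionRing A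
  let ι : A →ₐ[K] L := IsScalarTower.toAlgHom K A L
  have hι : Function.Injective ι := IsFractionRing.injective A L
  let M := IntermediateField.adjoin K (ι '' (T : Set A))
  have hfM : ι f ∈ M := by
    by_contra hcon
    let Φ : A ⊗[K] A →ₐ[K] L ⊗[M] L := Algebra.TensorProduct.lift
      (((Algebra.TensorProduct.includeLeft : L →ₐ[M] L ⊗[M] L).restrictScalars K).comp ι)
      (((Algebra.TensorProduct.includeRight : L →ₐ[M] L ⊗[M] L).restrictScalars K).comp ι)
      (fun _ _ => Commute.all _ _)
    have hΦ : ∀ x, Φ (d x) = ι x ⊗ₜ 1 - 1 ⊗ₜ ι x := fun x => by simp [Φ, d]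
    have hle : Ideal.span (d '' S) ≤ RingHom.ker Φ := by
      refine hspan.le.trans ?_
      refine Ideal.span_le.2 ?_
      intro y hy
      obtain ⟨x, hx, rfl⟩ := Finset.mem_image.1 (Finset.mem_coe.1 hy)
      have hxM : ι x ∈ M := IntermediateField.subset_adjoin _ _ ⟨x, hx, rfl⟩
      change Φ (d x) = 0
      rw [hΦ, sub_eq_zero]
      have := TensorProduct.smul_tmul (R := M) (⟨ι x, hxM⟩ : M) (1 : L) (1 : L)
      simpa [Algebra.smul_def] using this
    have h4 : Φ (d f) = 0 := hle (Ideal.subset_span ⟨f, hf, rfl⟩)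
    rw [hΦ, sub_eq_zero] at h4
    obtain ⟨c, hc⟩ := aux_descent M L (ι f) h4
    exact hcon (hc ▸ c.2)
  obtain ⟨r, hr, s, hs, hrs⟩ := IntermediateField.mem_adjoin_iff_div.1 hfM
  rw [← AlgHom.map_adjoin] at hr hs
  obtain ⟨a, ha, rfl⟩ := hr
  obtain ⟨b, hb, rfl⟩ := hs
  by_cases hb0 : b = 0
  · subst hb0
    have : f = 0 := hι (by simpa using hrs)
    exact ⟨0, zero_mem _, 1, one_mem _, one_ne_zero, by simp [this]⟩
  · refine ⟨a, ha, b, hb, hb0, hι ?_⟩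
    have : ι b ≠ 0 := fun h => hb0 (hι (by simpa using h))
    rw [map_mul, hrs]
    exact div_mul_cancel₀ _ this

/-- simultaneous eigenspace -/
def wsp {K A : Type*} [Field K] [CommRing A] [Algebra K A] {t : ℕ}
    (σ : Fin t → (A ≃ₐ[K] A)) (l : Fin t → Kˣ) : Submodule K A where
  carrier := {a | ∀ i, σ i a = (l i : K) • a}
  add_mem' := fun ha hb i => by simp [ha i, hb i]
  zero_mem' := fun i => by simp
  smul_mem' := fun c a ha i => by simp [ha i, smul_comm c]

lemma wsp_indep {K A : Type*} [Field K] [CommRing A] [Algebra K A] {t : ℕ}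
    (σ : Fin t → (A ≃ₐ[K] A))
    (hcomm : ∀ i j, ∀ x : A, σ i (σ j x) = σ j (σ i x)) : iSupIndep (wsp σ) := by
  have h := Module.End.independent_iInf_maxGenEigenspace_of_forall_mapsTo
    (fun i => (σ i).toLinearMap) (fun i j φ =>
      Module.End.mapsTo_maxGenEigenspace_of_comm (LinearMap.ext fun x => hcomm j i x) φ)
  have hinj : Function.Injective (fun (l : Fin t → Kˣ) (i : Fin t) => (l i : K)) := by
    intro l m hlm
    funext i
    exact Units.ext (congrFun hlm i)
  refine (h.comp hinj).mono fun l a ha => ?_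
  simp only [Function.comp, Submodule.mem_iInf]
  intro i
  refine (Module.End.genEigenspace _ _).mono (show (1 : ℕ∞) ≤ ⊤ from le_top) ?_
  exact Module.End.mem_eigenspace_iff.2 (ha i)

lemma wsp_mul {K A : Type*} [Field K] [CommRing A] [Algebra K A] {t : ℕ}
    {σ : Fin t → (A ≃ₐ[K] A)} {l m : Fin t → Kˣ} {a b : A} (ha : a ∈ wsp σ l)
    (hb : b ∈ wsp σ m) : a * b ∈ wsp σ (l * m) := fun i => by
  rw [map_mul, ha i, hb i]
  rw [smul_mul_smul_comm]
  simp

lemma wsp_mul_sup {K A : Type*} [Field K] [CommRing A] [Algebra K A] {t : ℕ}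
    {σ : Fin t → (A ≃ₐ[K] A)} {l : Fin t → Kˣ} {P Q : Set (Fin t → Kˣ)}
    (h : ∀ m ∈ P, l * m ∈ Q) {a b : A} (ha : a ∈ wsp σ l)
    (hb : b ∈ ⨆ m ∈ P, wsp σ m) : a * b ∈ ⨆ m ∈ Q, wsp σ m := by
  have : (⨆ m ∈ P, wsp σ m) ≤ (⨆ m ∈ Q, wsp σ m).comap (LinearMap.mulLeft K a) := by
    refine iSup₂_le fun m hm x hx => ?_
    exact (le_iSup₂_of_le (l * m) (h m hm) le_rfl :
      wsp σ (l * m) ≤ ⨆ m ∈ Q, wsp σ m) (wsp_mul ha hx)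
  exact this hb

lemma adjoin_sup {K A : Type*} [Field K] [CommRing A] [Algebra K A] {t : ℕ}
    {σ : Fin t → (A ≃ₐ[K] A)} (H : Subgroup (Fin t → Kˣ)) (T : Set A)
    (hT : ∀ f ∈ T, ∃ l ∈ H, f ∈ wsp σ l) {a : A} (ha : a ∈ Algebra.adjoin K T) :
    a ∈ ⨆ m ∈ (H : Set (Fin t → Kˣ)), wsp σ m := by
  have hle : ∀ l ∈ (H : Set (Fin t → Kˣ)), wsp σ l ≤ ⨆ m ∈ (H : Set (Fin t → Kˣ)), wsp σ m :=
    fun l hl => le_iSup₂_of_le l hl le_rfl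
  have h1 : (1 : A) ∈ wsp σ 1 := fun i => by simp
  induction ha using Algebra.adjoin_induction with
  | mem x hx => obtain ⟨l, hl, hf⟩ := hT x hx; exact hle l hl hf
  | algebraMap r =>
    rw [Algebra.algebraMap_eq_smul_one]
    exact Submodule.smul_mem _ _ (hle 1 H.one_mem h1)
  | add x y _ _ hx hy => exact add_mem hx hy
  | mul x y _ _ hx hy =>
    have : (⨆ m ∈ (H : Set (Fin t → Kˣ)), wsp σ m) ≤
        (⨆ m ∈ (H : Set (Fin t → Kˣ)), wsp σ m).comap (LinearMap.mulRight K y) := by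
      refine iSup₂_le fun m hm x hx => ?_
      exact wsp_mul_sup (fun n hn => H.mul_mem hm hn) hx hy
    exact this hx

lemma fin_tors {G : Type*} [CommGroup G] (H : Subgroup G) (hH : H.FG) :
    Set.Finite {x : G | x ∈ H ∧ ∃ n : ℕ, 0 < n ∧ x ^ n = 1} := by
  have : Group.FG H := (Group.fg_iff_subgroup_fg H).2 hH
  have h1 : Module.Finite ℤ (Additive H) := Module.Finite.iff_addGroup_fg.2 inferInstance
  have h2 : Finite (Submodule.torsion ℤ (Additive H)) :=
    Module.finite_of_fg_torsion _ (Submodule.torsion_isTorsion)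
  refine (Set.finite_range
    (fun x : Submodule.torsion ℤ (Additive H) => ((x.1.toMul : H) : G))).subset ?_
  rintro x ⟨hx, n, hn, hxn⟩
  refine ⟨⟨Additive.ofMul ⟨x, hx⟩, ?_⟩, rfl⟩
  rw [Submodule.mem_torsion_iff]
  refine ⟨⟨(n : ℤ), mem_nonZeroDivisors_of_ne_zero (by exact_mod_cast hn.ne')⟩, ?_⟩
  change (n : ℤ) • Additive.ofMul (⟨x, hx⟩ : H) = 0
  rw [natCast_zsmul, ← ofMul_pow]
  have : (⟨x, hx⟩ : H) ^ n = 1 := Subtype.ext hxn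
  rw [this]; rfl

/-- Let `A` be a commutative domain which is a finitely generated `K`-algebra
and `σ₁, …, σ_t` pairwise commuting `K`-algebra automorphisms of `A`.  Then the subgroup of
`(Kˣ)^t` generated by the monoid `Ev(Δ, A)` of common eigenvalues is finitely generated, and
the set of torsion elements of `Ev(Δ, A)` is finite. -/
theorem stmt10 (K A : Type*) [Field K] [CommRing A] [IsDomain A] [Algebra K A]
    (hfg : Algebra.FiniteType K A)
    (t : ℕ) (σ : Fin t → (A ≃ₐ[K] A))
    (hcomm : ∀ i j, ∀ x : A, σ i (σ j x) = σ j (σ i x)) :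
    (Subgroup.closure
      {lam : Fin t → Kˣ | ∃ a : A, a ≠ 0 ∧ ∀ i, σ i a = (lam i : K) • a}).FG ∧
    Set.Finite {lam : Fin t → Kˣ |
      (∃ a : A, a ≠ 0 ∧ ∀ i, σ i a = (lam i : K) • a) ∧ ∃ n : ℕ, 0 < n ∧ lam ^ n = 1} := by
  classical
  have key : (Subgroup.closure
      {lam : Fin t → Kˣ | ∃ a : A, a ≠ 0 ∧ ∀ i, σ i a = (lam i : K) • a}).FG := by
    obtain ⟨T, hTS, hT⟩ := aux_fin K A hfg {a : A | a ≠ 0 ∧ ∃ l, a ∈ wsp σ l}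
    choose g hg using fun x : T => (hTS x.2).2
    refine ⟨Finset.univ.image g, ?_⟩
    apply le_antisymm
    · refine Subgroup.closure_mono ?_
      intro l hl
      obtain ⟨x, -, rfl⟩ := Finset.mem_image.1 (Finset.mem_coe.1 hl)
      exact ⟨x, (hTS x.2).1, hg x⟩
    · rw [Subgroup.closure_le]
      rintro l ⟨f, hf0, hf⟩
      set H := Subgroup.closure ((Finset.univ.image g : Finset _) : Set (Fin t → Kˣ)) with hH
      have hTH : ∀ f ∈ (T : Set A), ∃ l ∈ H, f ∈ wsp σ l := fun x hx =>
        ⟨g ⟨x, hx⟩, Subgroup.subset_closure (by simp), hg ⟨x, hx⟩⟩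
      obtain ⟨a, ha, b, hb, hb0, hab⟩ := hT f ⟨hf0, l, hf⟩
      by_contra hl
      have h1 : f * b ∈ ⨆ m ∈ {m | l⁻¹ * m ∈ H}, wsp σ m :=
        wsp_mul_sup (P := (H : Set (Fin t → Kˣ))) (fun m hm => by simpa using hm) hf
          (adjoin_sup H _ hTH hb)
      have h2 : f * b ∈ ⨆ m ∈ (H : Set (Fin t → Kˣ)), wsp σ m := hab ▸ adjoin_sup H _ hTH ha
      have hd : Disjoint {m | l⁻¹ * m ∈ H} (H : Set (Fin t → Kˣ)) := by
        rw [Set.disjoint_left]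
        intro m hm hm'
        exact hl (by simpa using H.inv_mem ((H.mul_mem_cancel_right hm').1 hm))
      have h3 := (wsp_indep σ hcomm).disjoint_biSup_biSup hd
      exact mul_ne_zero hf0 hb0 (Submodule.disjoint_def.1 h3 _ h1 h2)
  refine ⟨key, (fin_tors _ key).subset ?_⟩
  rintro l ⟨hl, hn⟩
  exact ⟨Subgroup.subset_closure hl, hn⟩
end

section
/- Let K be a field, A a K-algebra which is a domain, and D a division ring containing A as a K-subalgebra such that every element of D can be written as s⁻¹a with a, s ∈ A and s ≠ 0, and assume that D ⊗_K D^o is a Noetherian ring. Let δ₁, …, δ_t be pairwise commuting K-derivations of A, and Ev(Δ, A) := { λ ∈ K^t : there exists a ∈ A, a ≠ 0, with δᵢ(a) = λᵢ·a for all i }. Then the subgroup of (K^t, +) generated by Ev(Δ, A) is a finitely generated abelian group. -/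
open TensorProduct
namespace Ev

theorem extend_der {K D : Type*} [Field K] [DivisionRing D] [Algebra K D]
    (A : Subalgebra K D)
    (hquot : ∀ d : D, ∃ a s : D, a ∈ A ∧ s ∈ A ∧ s ≠ 0 ∧ d = s⁻¹ * a)
    (δ : ↥A →ₗ[K] ↥A)
    (hLeib : ∀ a b : ↥A, δ (a * b) = δ a * b + a * δ b) :
    ∃ f : D →ₗ[K] D, (∀ x y, f (x * y) = f x * y + x * f y) ∧ ∀ a : A, f a = δ a := by
  have hq : ∀ d : D, ∃ s a : A, (s : D) ≠ 0 ∧ (s : D) * d = a := by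
    intro d
    obtain ⟨a, s, ha, hs, hs0, rfl⟩ := hquot d
    exact ⟨⟨s, hs⟩, ⟨a, ha⟩, hs0, by simp [hs0]⟩
  have hore : ∀ x y : A, (y : D) ≠ 0 → ∃ u v : A, (u : D) ≠ 0 ∧ (u : D) * x = v * y := by
    intro x y hy
    obtain ⟨u, v, hu, h⟩ := hq ((x : D) * (y : D)⁻¹)
    refine ⟨u, v, hu, ?_⟩
    rw [← h, mul_assoc, mul_assoc, inv_mul_cancel₀ hy, mul_one]
  have hL : ∀ a b : A, ((δ (a * b) : A) : D) = δ a * b + a * δ b := by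
    intro a b; rw [hLeib]; simp
  have hwd : ∀ d : D, ∃ e : D, ∀ s a : A, (s : D) * d = a →
      (s : D) * e = δ a - δ s * d := by
    intro d
    obtain ⟨r, b, hr, hrb⟩ := hq d
    refine ⟨(r : D)⁻¹ * (δ b - δ r * d), ?_⟩
    intro s a hsa
    obtain ⟨u, v, hu, huv⟩ := hore s r hr
    apply mul_left_cancel₀ hu
    have h1 : u * s = v * r := Subtype.ext huv
    have h2 : u * a = v * b := by
      apply Subtype.ext
      push_cast
      rw [← hsa, ← hrb, ← mul_assoc, ← mul_assoc, huv]
    have h3 := hL u s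
    have h4 := hL v r
    have h5 := hL u a
    have h6 := hL v b
    rw [h1, h4] at h3
    rw [h2, h6] at h5
    calc (u : D) * (s * ((r : D)⁻¹ * (δ b - δ r * d)))
        = (u * s) * (r : D)⁻¹ * (δ b - δ r * d) := by simp only [mul_assoc]
      _ = v * (δ b - δ r * d) := by rw [huv, mul_assoc _ (r : D), mul_inv_cancel₀ hr, mul_one]
      _ = (δ v * b + v * δ b) - (δ v * r + v * δ r) * d := by rw [← hrb]; noncomm_ring
      _ = u * (δ a - δ s * d) := by rw [h5, h3, ← hsa]; noncomm_ring
  choose f hf using hwd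
  have hadd : ∀ x y, f (x + y) = f x + f y := by
    intro x y
    obtain ⟨s, a, hs, hsa⟩ := hq x
    obtain ⟨r, b, hr, hrb⟩ := hq y
    obtain ⟨u, v, hu, huv⟩ := hore s r hr
    have e1 : ((u * s : A) : D) * x = ((u * a : A) : D) := by
      push_cast; rw [mul_assoc, hsa]
    have e2 : ((u * s : A) : D) * y = ((v * b : A) : D) := by
      push_cast; rw [huv, mul_assoc, hrb]
    have e3 : ((u * s : A) : D) * (x + y) = ((u * a + v * b : A) : D) := by
      rw [mul_add, e1, e2]; rfl
    have h0 : ((u * s : A) : D) ≠ 0 := by push_cast; exact mul_ne_zero hu hs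
    apply mul_left_cancel₀ h0
    rw [hf _ _ _ e3, mul_add _ (f x), hf _ _ _ e1, hf _ _ _ e2, map_add]
    push_cast
    noncomm_ring
  have hmul : ∀ x y, f (x * y) = f x * y + x * f y := by
    intro x y
    obtain ⟨s, a, hs, hsa⟩ := hq x
    obtain ⟨r, b, hr, hrb⟩ := hq y
    obtain ⟨u, v, hu, huv⟩ := hore a r hr
    have e1 : ((u * s : A) : D) * x = ((v * r : A) : D) := by
      push_cast; rw [mul_assoc, hsa, huv]
    have e3 : ((u * s : A) : D) * (x * y) = ((v * b : A) : D) := by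
      rw [← mul_assoc, e1]; push_cast; rw [mul_assoc, hrb]
    have h0 : ((u * s : A) : D) ≠ 0 := by push_cast; exact mul_ne_zero hu hs
    apply mul_left_cancel₀ h0
    have e4 : ((u * s : A) : D) * (x * f y) = v * (δ b - δ r * y) := by
      rw [← mul_assoc, e1, ← hf _ _ _ hrb]; push_cast; rw [mul_assoc]
    rw [hf _ _ _ e3, mul_add, ← mul_assoc _ (f x), hf _ _ _ e1, e4, hL v b, hL v r, ← hrb]
    noncomm_ring
  have hext : ∀ a : A, f a = δ a := by
    intro a
    have h := hf (a : D) 1 a (by simp)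
    have h1 : ((δ 1 : A) : D) = 0 := by
      have := hL 1 1
      simpa using this
    simpa [h1] using h
  have halg : ∀ k : K, f (algebraMap K D k) = 0 := by
    intro k
    have h1 : δ (algebraMap K A k) = 0 := by
      have h2 := hLeib 1 1
      simp at h2
      rw [Algebra.algebraMap_eq_smul_one, map_smul, h2, smul_zero]
    have := hext (algebraMap K A k)
    rw [h1] at this
    simpa using this
  refine ⟨{ toFun := f, map_add' := hadd, map_smul' := ?_ }, hmul, hext⟩
  intro k x
  rw [Algebra.smul_def, hmul, halg]
  simp [Algebra.smul_def]

/-- In an abelian group, finite sets have subexponential growth. -/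
theorem folner {G : Type*} [AddCommGroup G] [DecidableEq G] (F : Finset G) (H : AddSubgroup G)
    (hF : ∀ x ∈ F, x ∈ H) :
    ∃ B : Finset G, (∀ x ∈ B, x ∈ H) ∧
      (Finset.image₂ (· + ·) B F).card < 2 * B.card := by
  by_contra! hcon
  have key : ∀ k : ℕ, ∃ B : Finset G, (∀ x ∈ B, x ∈ H) ∧ 2 ^ k ≤ B.card ∧
      ∀ x ∈ B, ∃ c : G → ℕ, (∀ f, c f ≤ k) ∧ x = ∑ f ∈ F, c f • f := by
    intro k
    induction k with
    | zero =>
      refine ⟨{0}, by simp, by simp, ?_⟩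
      intro x hx
      exact ⟨fun _ => 0, by simp, by simpa using hx⟩
    | succ k ih =>
      obtain ⟨B, hB, hc, hrep⟩ := ih
      refine ⟨Finset.image₂ (· + ·) B F, ?_, ?_, ?_⟩
      · intro x hx
        obtain ⟨b, hb, f, hf, rfl⟩ := Finset.mem_image₂.1 hx
        exact H.add_mem (hB b hb) (hF f hf)
      · have := hcon B hB
        rw [pow_succ]; omega
      · intro x hx
        obtain ⟨b, hb, f, hf, rfl⟩ := Finset.mem_image₂.1 hx
        obtain ⟨c, hc, rfl⟩ := hrep b hb
        refine ⟨fun g => c g + if g = f then 1 else 0, ?_, ?_⟩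
        · intro g
          have := hc g
          dsimp only
          split_ifs <;> omega
        · simp [add_smul, Finset.sum_add_distrib, ite_smul, hf]
  have bound : ∀ k : ℕ, 2 ^ k ≤ (k + 1) ^ F.card := by
    intro k
    obtain ⟨B, -, hc, hrep⟩ := key k
    refine hc.trans ?_
    have hsub : B ⊆ (Fintype.piFinset (fun _ : F => Finset.range (k + 1))).image
        (fun c => ∑ f : F, c f • (f : G)) := by
      intro x hx
      obtain ⟨c, hc, rfl⟩ := hrep x hx
      refine Finset.mem_image.2 ⟨fun f => c f, ?_, ?_⟩
      · simp only [Fintype.mem_piFinset, Finset.mem_range]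
        intro f; have := hc f; omega
      · exact Finset.sum_coe_sort F (fun f => c f • f)
    refine (Finset.card_le_card hsub).trans (Finset.card_image_le.trans ?_)
    simp
  have lim := tendsto_pow_const_div_const_pow_of_one_lt F.card (r := (2 : ℝ)) (by norm_num)
  have ev := lim.eventually (gt_mem_nhds (show (0 : ℝ) < 1 / 2 by norm_num))
  obtain ⟨n, hn, hn1⟩ := (ev.and (Filter.eventually_ge_atTop 1)).exists
  obtain ⟨k, rfl⟩ : ∃ k, n = k + 1 := ⟨n - 1, by omega⟩
  have hb : ((2 : ℝ) ^ k) ≤ ((k + 1 : ℕ) : ℝ) ^ F.card := by exact_mod_cast bound k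
  rw [div_lt_iff₀ (by positivity), pow_succ] at hn
  linarith

section eig

variable {K D ι : Type*} [Field K] [DivisionRing D] [Algebra K D] (p : ι → D →ₗ[K] D)

/-- `x` is a common eigenvector (or zero) with eigenvalue `μ`. -/
def IsEig (μ : ι → K) (x : D) : Prop := ∀ i, p i x = μ i • x

variable {p}

theorem IsEig.mul (hp : ∀ i x y, p i (x * y) = p i x * y + x * p i y)
    {μ ν : ι → K} {x y : D} (hx : IsEig p μ x) (hy : IsEig p ν y) :
    IsEig p (μ + ν) (x * y) := by
  intro i
  rw [hp, hx i, hy i, Pi.add_apply, add_smul, smul_mul_assoc, mul_smul_comm]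

theorem isEig_one (hp : ∀ i x y, p i (x * y) = p i x * y + x * p i y) :
    IsEig p 0 (1 : D) := by
  intro i
  have := hp i 1 1
  simp only [mul_one, one_mul] at this
  simpa using this

theorem IsEig.inv (hp : ∀ i x y, p i (x * y) = p i x * y + x * p i y)
    {μ : ι → K} {x : D} (hx : IsEig p μ x) :
    IsEig p (-μ) x⁻¹ := by
  intro i
  by_cases h0 : x = 0
  · subst h0; simp
  have h := hp i x x⁻¹
  rw [mul_inv_cancel₀ h0, isEig_one hp i, hx i] at h
  apply mul_left_cancel₀ h0
  rw [smul_mul_assoc, mul_inv_cancel₀ h0] at h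
  rw [mul_smul_comm, mul_inv_cancel₀ h0, Pi.neg_apply, neg_smul]
  simp only [Pi.zero_apply, zero_smul] at h
  exact (neg_eq_of_add_eq_zero_right h.symm).symm

theorem IsEig.add {μ : ι → K} {x y : D} (hx : IsEig p μ x) (hy : IsEig p μ y) :
    IsEig p μ (x + y) := by
  intro i
  rw [map_add, hx i, hy i, smul_add]

theorem isEig_zero (μ : ι → K) : IsEig p μ (0 : D) := by
  intro i; simp

theorem IsEig.smul {μ : ι → K} {x : D} (k : K) (hx : IsEig p μ x) : IsEig p μ (k • x) := by
  intro i
  rw [map_smul, hx i, smul_comm]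

/-- The division ring of constants. -/
def const (hp : ∀ i x y, p i (x * y) = p i x * y + x * p i y) : Subfield D where
  carrier := {x | IsEig p 0 x}
  mul_mem' {a b} ha hb := by simpa using IsEig.mul hp ha hb
  one_mem' := isEig_one hp
  add_mem' ha hb := IsEig.add ha hb
  zero_mem' := isEig_zero 0
  neg_mem' {x} hx := by
    have := IsEig.smul (-1 : K) hx
    simpa using this
  inv_mem' x hx := by simpa using IsEig.inv hp hx

/-- Eigenspaces, as left subspaces over the constants. -/
def V (hp : ∀ i x y, p i (x * y) = p i x * y + x * p i y) (μ : ι → K) :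
    Submodule (const hp) D where
  carrier := {x | IsEig p μ x}
  add_mem' ha hb := IsEig.add ha hb
  zero_mem' := isEig_zero μ
  smul_mem' c x hx := by
    have := IsEig.mul hp c.2 hx
    rwa [zero_add] at this

variable (hp : ∀ i x y, p i (x * y) = p i x * y + x * p i y)

theorem mem_V {μ : ι → K} {x : D} : x ∈ V hp μ ↔ IsEig p μ x := Iff.rfl

theorem V_indep : iSupIndep (V hp) := by
  classical
  rw [iSupIndep_iff_finsetSum_eq_zero_imp_eq_zero]
  intro B
  induction B using Finset.induction_on with
  | empty => simp
  | insert ν B hν ih =>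
    intro v hv hsum
    have hB : ∀ μ ∈ B, v μ = 0 := by
      intro μ hμ
      have hne : μ ≠ ν := fun h => hν (h ▸ hμ)
      obtain ⟨i, hi⟩ := Function.ne_iff.1 hne
      have h1 : ∑ μ ∈ B, (μ i - ν i) • v μ = 0 := by
        have h2 : p i (∑ μ ∈ insert ν B, v μ) - ν i • (∑ μ ∈ insert ν B, v μ) = 0 := by
          rw [hsum]; simp
        rw [map_sum, Finset.smul_sum, ← Finset.sum_sub_distrib, Finset.sum_insert hν,
          (hv ν (Finset.mem_insert_self _ _)) i, sub_self, zero_add] at h2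
        rw [← h2]
        refine Finset.sum_congr rfl fun κ hκ => ?_
        rw [(hv κ (Finset.mem_insert_of_mem hκ)) i, sub_smul]
      have h3 := ih (fun μ => (μ i - ν i) • v μ)
        (fun κ hκ => IsEig.smul _ (hv κ (Finset.mem_insert_of_mem hκ))) h1 μ hμ
      exact (smul_eq_zero.1 h3).resolve_left (sub_ne_zero.2 hi)
    intro κ hκ
    rcases Finset.mem_insert.1 hκ with rfl | h
    · rw [Finset.sum_insert hν, Finset.sum_eq_zero hB, add_zero] at hsum
      exact hsum
    · exact hB κ h

/-- Sums of eigenvectors with eigenvalues in `B`. -/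
def E (B : Set (ι → K)) : Submodule (const hp) D :=
  Submodule.span (const hp) {x | ∃ μ ∈ B, IsEig p μ x}

theorem E_le (B : Set (ι → K)) : E hp B ≤ ⨆ μ ∈ B, V hp μ := by
  refine Submodule.span_le.2 ?_
  rintro x ⟨μ, hμ, hx⟩
  exact (le_iSup₂_of_le (f := fun μ (_ : μ ∈ B) => V hp μ) μ hμ le_rfl) hx

theorem E_disjoint {B C : Set (ι → K)} (h : Disjoint B C) {x : D} (hx : x ∈ E hp B)
    (hx' : x ∈ E hp C) : x = 0 :=
  Submodule.disjoint_def.1 ((V_indep hp).disjoint_biSup_biSup h) x (E_le hp B hx) (E_le hp C hx')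

theorem mem_E {B : Set (ι → K)} {μ : ι → K} (hμ : μ ∈ B) {x : D} (hx : IsEig p μ x) :
    x ∈ E hp B := Submodule.subset_span ⟨μ, hμ, hx⟩

theorem E_mul {B F C : Set (ι → K)} (h : ∀ μ ∈ B, ∀ ν ∈ F, μ + ν ∈ C) {x y : D}
    (hx : x ∈ E hp B) (hy : y ∈ E hp F) : x * y ∈ E hp C := by
  have h1 : ∀ μ ∈ B, ∀ x, IsEig p μ x → x * y ∈ E hp C := by
    intro μ hμ
    refine Submodule.span_induction (p := fun y _ => ∀ x, IsEig p μ x → x * y ∈ E hp C)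
      ?_ ?_ ?_ ?_ hy
    · rintro y ⟨ν, hν, hy⟩ x hx
      exact mem_E hp (h μ hμ ν hν) (hx.mul hp hy)
    · intro x _; rw [mul_zero]; exact zero_mem _
    · intro y z _ _ hy hz x hx
      rw [mul_add]; exact add_mem (hy x hx) (hz x hx)
    · intro c y _ hy x hx
      have := hx.mul hp c.2
      rw [add_zero] at this
      have h2 := hy _ this
      rw [mul_assoc] at h2
      exact h2
  refine Submodule.span_induction (p := fun x _ => x * y ∈ E hp C) ?_ ?_ ?_ ?_ hx
  · rintro x ⟨μ, hμ, hx⟩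
    exact h1 μ hμ x hx
  · rw [zero_mul]; exact zero_mem _
  · intro a b _ _ ha hb
    rw [add_mul]; exact add_mem ha hb
  · intro c a _ ha
    have := (E hp C).smul_mem c ha
    rwa [← smul_mul_assoc] at this

/-- The group of eigenvalues in `D`. -/
def Gam : AddSubgroup (ι → K) where
  carrier := {μ | ∃ x : D, x ≠ 0 ∧ IsEig p μ x}
  add_mem' := by
    rintro a b ⟨x, hx, hx'⟩ ⟨y, hy, hy'⟩
    exact ⟨x * y, mul_ne_zero hx hy, hx'.mul hp hy'⟩
  zero_mem' := ⟨1, one_ne_zero, isEig_one hp⟩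
  neg_mem' := by
    rintro a ⟨x, hx, hx'⟩
    exact ⟨x⁻¹, inv_ne_zero hx, hx'.inv hp⟩

theorem E_mono {B C : Set (ι → K)} (h : B ⊆ C) : E hp B ≤ E hp C :=
  Submodule.span_mono fun _ ⟨μ, hμ, hx⟩ => ⟨μ, h hμ, hx⟩

theorem E_finite {H : Set (ι → K)} {x : D} (hx : x ∈ E hp H) :
    ∃ F : Finset (ι → K), (F : Set (ι → K)) ⊆ H ∩ Gam hp ∧ x ∈ E hp F := by
  classical
  refine Submodule.span_induction (p := fun x _ => ∃ F : Finset (ι → K),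
    (F : Set (ι → K)) ⊆ H ∩ Gam hp ∧ x ∈ E hp F) ?_ ?_ ?_ ?_ hx
  · rintro x ⟨μ, hμ, hx⟩
    by_cases h0 : x = 0
    · exact ⟨∅, by simp, by rw [h0]; exact zero_mem _⟩
    · refine ⟨{μ}, ?_, mem_E hp (by simp) hx⟩
      simp only [Finset.coe_singleton, Set.singleton_subset_iff]
      exact ⟨hμ, x, h0, hx⟩
  · exact ⟨∅, by simp, zero_mem _⟩
  · rintro x y _ _ ⟨F, hF, hx⟩ ⟨F', hF', hy⟩
    refine ⟨F ∪ F', by rw [Finset.coe_union]; exact Set.union_subset hF hF', add_mem (E_mono hp ?_ hx) (E_mono hp ?_ hy)⟩ <;> simp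
  · rintro c x _ ⟨F, hF, hx⟩
    exact ⟨F, hF, (E hp F).smul_mem c hx⟩

theorem E_ore (H : AddSubgroup (ι → K)) {s t : D} (hs : s ∈ E hp (H : Set (ι → K)))
    (ht : t ∈ E hp (H : Set (ι → K))) (ht0 : t ≠ 0) :
    ∃ u v : D, u ∈ E hp (H : Set (ι → K)) ∧ v ∈ E hp (H : Set (ι → K)) ∧ u ≠ 0 ∧
      u * s = v * t := by
  classical
  obtain ⟨F₁, hF₁, hs'⟩ := E_finite hp hs
  obtain ⟨F₂, hF₂, ht'⟩ := E_finite hp ht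
  set F := F₁ ∪ F₂ with hFdef
  have hsF : s ∈ E hp (F : Set (ι → K)) := E_mono hp (by simp [hFdef]) hs'
  have htF : t ∈ E hp (F : Set (ι → K)) := E_mono hp (by simp [hFdef]) ht'
  obtain ⟨B, hB, hcard⟩ := folner F (H ⊓ Gam hp) (by
    intro x hx
    rcases Finset.mem_union.1 hx with h | h
    · exact hF₁ h
    · exact hF₂ h)
  set C := Finset.image₂ (· + ·) B F with hC
  have hex : ∀ μ : ι → K, ∃ e : D, IsEig p μ e ∧ (μ ∈ Gam hp → e ≠ 0) ∧
      ∀ x, IsEig p μ x → x ∈ Submodule.span (const hp) {e} := by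
    intro μ
    by_cases h : μ ∈ Gam hp
    · obtain ⟨e, he0, he⟩ := id h
      refine ⟨e, he, fun _ => he0, fun x hx => ?_⟩
      have hc : IsEig p 0 (x * e⁻¹) := by
        have := hx.mul hp (he.inv hp)
        rwa [add_neg_cancel] at this
      refine Submodule.mem_span_singleton.2 ⟨⟨x * e⁻¹, hc⟩, ?_⟩
      change x * e⁻¹ * e = x
      rw [mul_assoc, inv_mul_cancel₀ he0, mul_one]
    · refine ⟨0, isEig_zero μ, fun h' => absurd h' h, fun x hx => ?_⟩
      by_cases h0 : x = 0
      · rw [h0]; exact zero_mem _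
      · exact absurd ⟨x, h0, hx⟩ h
  choose e he he0 hespan using hex
  have hli : LinearIndependent (const hp) (fun μ : B => e μ) :=
    ((V_indep hp).comp Subtype.val_injective).linearIndependent _ (fun μ => he μ)
      (fun μ => he0 μ (hB μ μ.2).2)
  have hEC : E hp (C : Set (ι → K)) ≤ Submodule.span (const hp) ((C.image e : Finset D) : Set D) := by
    refine Submodule.span_le.2 ?_
    rintro x ⟨μ, hμ, hx⟩
    refine Submodule.span_mono ?_ (hespan μ x hx)
    simp only [Set.singleton_subset_iff, Finset.coe_image]
    exact ⟨μ, hμ, rfl⟩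
  have hmulC : ∀ μ ∈ B, ∀ x ∈ E hp (F : Set (ι → K)), e μ * x ∈ E hp (C : Set (ι → K)) := by
    intro μ hμ x hx
    refine E_mul hp (B := (B : Set (ι → K))) (F := (F : Set (ι → K))) ?_ (mem_E hp hμ (he μ)) hx
    intro a ha b hb
    exact Finset.mem_image₂_of_mem ha hb
  have hnot : ¬ LinearIndependent (const hp)
      (Sum.elim (fun μ : B => e μ * s) (fun μ : B => e μ * t)) := by
    intro hl
    have h1 := finrank_span_eq_card hl
    have h2 : Submodule.span (const hp)
        (Set.range (Sum.elim (fun μ : B => e μ * s) (fun μ : B => e μ * t))) ≤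
        Submodule.span (const hp) ((C.image e : Finset D) : Set D) := by
      refine Submodule.span_le.2 ?_
      rintro _ ⟨μ | μ, rfl⟩
      · exact hEC (hmulC μ μ.2 s hsF)
      · exact hEC (hmulC μ μ.2 t htF)
    have h3 := Submodule.finrank_mono h2
    have h4 : Module.finrank (const hp)
      (Submodule.span (const hp) ((C.image e : Finset D) : Set D)) ≤ (C.image e).card :=
      finrank_span_finset_le_card _
    have h5 : (C.image e).card ≤ C.card := Finset.card_image_le
    rw [h1] at h3
    simp only [Fintype.card_sum, Fintype.card_coe] at h3
    omega
  obtain ⟨g, hg, j, hj⟩ := Fintype.not_linearIndependent_iff.1 hnot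
  rw [Fintype.sum_sum_type] at hg
  simp only [Sum.elim_inl, Sum.elim_inr] at hg
  have hmemE : ∀ c : B → const hp, ∑ μ, c μ • e μ ∈ E hp (H : Set (ι → K)) := by
    intro c
    refine Submodule.sum_mem _ fun μ _ => Submodule.smul_mem _ _ ?_
    exact mem_E hp (hB μ μ.2).1 (he μ)
  set u := ∑ μ, g (Sum.inl μ) • e μ with hu
  set v := ∑ μ, g (Sum.inr μ) • e μ with hv
  have huv : u * s + v * t = 0 := by
    rw [← hg, hu, hv, Finset.sum_mul, Finset.sum_mul]
    simp only [smul_mul_assoc]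
  refine ⟨u, -v, hmemE _, neg_mem (hmemE _), ?_, ?_⟩
  · intro hu0
    have hv0 : v = 0 := by
      rw [hu0, zero_mul, zero_add] at huv
      exact (mul_eq_zero.1 huv).resolve_right ht0
    have a1 := Fintype.linearIndependent_iff.1 hli _ hu0
    have a2 := Fintype.linearIndependent_iff.1 hli _ hv0
    rcases j with j | j
    · exact hj (a1 j)
    · exact hj (a2 j)
  · rw [neg_mul]; exact eq_neg_of_add_eq_zero_left huv

/-- The division ring of fractions of `E H`. -/
def S (H : AddSubgroup (ι → K)) : Subfield D where
  carrier := {d | ∃ s b : D, s ∈ E hp (H : Set (ι → K)) ∧ b ∈ E hp (H : Set (ι → K)) ∧ s ≠ 0 ∧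
    s * d = b}
  mul_mem' := by
    rintro d d' ⟨s, b, hs, hb, hs0, hd⟩ ⟨s', b', hs', hb', hs0', hd'⟩
    obtain ⟨u, v, hu, hv, hu0, huv⟩ := E_ore hp H hb hs' hs0'
    refine ⟨u * s, v * b', E_mul hp (fun _ a _ b => H.add_mem a b) hu hs,
      E_mul hp (fun _ a _ b => H.add_mem a b) hv hb', mul_ne_zero hu0 hs0, ?_⟩
    rw [← hd', ← mul_assoc v, ← huv, ← hd]
    simp only [mul_assoc]
  one_mem' := ⟨1, 1, mem_E hp H.zero_mem (isEig_one hp), mem_E hp H.zero_mem (isEig_one hp),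
    one_ne_zero, one_mul 1⟩
  add_mem' := by
    rintro d d' ⟨s, b, hs, hb, hs0, hd⟩ ⟨s', b', hs', hb', hs0', hd'⟩
    obtain ⟨u, v, hu, hv, hu0, huv⟩ := E_ore hp H hs hs' hs0'
    refine ⟨u * s, u * b + v * b', E_mul hp (fun _ a _ b => H.add_mem a b) hu hs,
      add_mem (E_mul hp (fun _ a _ b => H.add_mem a b) hu hb)
        (E_mul hp (fun _ a _ b => H.add_mem a b) hv hb'), mul_ne_zero hu0 hs0, ?_⟩
    rw [mul_add, ← hd, ← hd', ← mul_assoc, ← mul_assoc, ← huv]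
  zero_mem' := ⟨1, 0, mem_E hp H.zero_mem (isEig_one hp), zero_mem _, one_ne_zero, mul_zero _⟩
  neg_mem' := by
    rintro d ⟨s, b, hs, hb, hs0, hd⟩
    exact ⟨s, -b, hs, neg_mem hb, hs0, by rw [mul_neg, hd]⟩
  inv_mem' := by
    rintro d ⟨s, b, hs, hb, hs0, hd⟩
    by_cases h0 : d = 0
    · subst h0
      exact ⟨1, 0, mem_E hp H.zero_mem (isEig_one hp), zero_mem _, one_ne_zero, by simp⟩
    · refine ⟨b, s, hb, hs, ?_, ?_⟩
      · rw [← hd]; exact mul_ne_zero hs0 h0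
      · rw [← hd, mul_assoc, mul_inv_cancel₀ h0, mul_one]

theorem mem_S {H : AddSubgroup (ι → K)} {μ : ι → K} (hμ : μ ∈ H) {x : D} (hx : IsEig p μ x) :
    x ∈ S hp H :=
  ⟨1, x, mem_E hp H.zero_mem (isEig_one hp), mem_E hp hμ hx, one_ne_zero, one_mul x⟩

theorem notMem_S {H : AddSubgroup (ι → K)} {μ : ι → K} (hμ : μ ∉ H) {x : D} (hx0 : x ≠ 0)
    (hx : IsEig p μ x) : x ∉ S hp H := by
  rintro ⟨s, b, hs, hb, hs0, h⟩
  have h1 : s * x ∈ E hp {κ | κ - μ ∈ H} := by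
    refine E_mul hp (B := (H : Set (ι → K))) (F := {μ}) ?_ hs (mem_E hp (Set.mem_singleton μ) hx)
    intro a ha b hb
    rw [Set.mem_singleton_iff.1 hb]
    change a + μ - μ ∈ H
    rw [add_sub_cancel_right]
    exact ha
  rw [h] at h1
  have h2 : b = 0 := by
    refine E_disjoint hp ?_ hb h1
    rw [Set.disjoint_left]
    intro κ hκ hκ'
    apply hμ
    have := H.sub_mem hκ hκ'
    rwa [sub_sub_cancel] at this
  rw [h2] at h
  exact mul_ne_zero hs0 hx0 h

end eig

section bimod

variable (K D : Type*) [Field K] [DivisionRing D] [Algebra K D]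

/-- Left action on `Hom_K(D, D)`. -/
def actL : D →ₐ[K] Module.End K (D →ₗ[K] D) :=
  AlgHom.ofLinearMap
    { toFun := fun d => LinearMap.compRight K (LinearMap.mulLeft K d)
      map_add' := by intro a b; ext P x; simp [add_mul]
      map_smul' := by intro a b; ext P x; simp }
    (by ext P x; simp)
    (by intro a b; ext P x; simp [mul_assoc])

/-- Right action on `Hom_K(D, D)`. -/
def actR : Dᵐᵒᵖ →ₐ[K] Module.End K (D →ₗ[K] D) :=
  AlgHom.ofLinearMap
    { toFun := fun d => LinearMap.lcomp K D (LinearMap.mulLeft K d.unop)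
      map_add' := by intro a b; ext P x; simp [add_mul]
      map_smul' := by intro a b; ext P x; simp }
    (by ext P x; simp)
    (by intro a b; ext P x; simp [mul_assoc])

/-- The action of `D ⊗ Dᵒᵖ` on `Hom_K(D, D)`. -/
noncomputable def act : D ⊗[K] Dᵐᵒᵖ →ₐ[K] Module.End K (D →ₗ[K] D) :=
  Algebra.TensorProduct.lift (actL K D) (actR K D) (by
    intro a b
    ext P x
    simp [actL, actR])

/-- The basic elements `a ⊗ 1 - 1 ⊗ a`. -/
noncomputable def dd (a : D) : D ⊗[K] Dᵐᵒᵖ := a ⊗ₜ 1 - 1 ⊗ₜ MulOpposite.op a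

theorem act_dd (a : D) (P : D →ₗ[K] D) (x : D) :
    act K D (dd K D a) P x = a * P x - P (a * x) := by
  simp [act, dd, actL, actR]

theorem dd_notMem (S : Subfield D) (hK : ∀ k : K, algebraMap K D k ∈ S)
    (T : Set D) (hT : ∀ a ∈ T, a ∈ S) (a : D) (ha : a ∉ S) :
    dd K D a ∉ Submodule.span (D ⊗[K] Dᵐᵒᵖ) (dd K D '' T) := by
  have h1 : a ∉ Submodule.span S ({1} : Set D) := by
    intro h
    obtain ⟨c, hc⟩ := Submodule.mem_span_singleton.1 h
    apply ha
    rw [← hc]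
    have : c • (1 : D) = c := mul_one _
    rw [this]
    exact c.2
  obtain ⟨f, hfa, hf⟩ := Submodule.exists_le_ker_of_notMem h1
  have hf1 : f 1 = 0 := hf (Submodule.mem_span_singleton_self 1)
  have hlin : ∀ c ∈ S, ∀ x : D, (f (c * x) : D) = c * f x := by
    intro c hc x
    have := f.map_smul ⟨c, hc⟩ x
    exact congrArg Subtype.val this
  let P : D →ₗ[K] D :=
    { toFun := fun x => f x
      map_add' := by intro x y; simp
      map_smul' := by
        intro k x
        rw [Algebra.smul_def, hlin _ (hK k), RingHom.id_apply, Algebra.smul_def] }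
  intro hmem
  have hkill : act K D (dd K D a) P = 0 := by
    refine Submodule.span_induction (p := fun z _ => act K D z P = 0) ?_ ?_ ?_ ?_ hmem
    · rintro _ ⟨b, hb, rfl⟩
      ext x
      rw [act_dd]
      change b * (f x : D) - f (b * x) = 0
      rw [hlin b (hT b hb), sub_self]
    · simp
    · intro x y _ _ hx hy
      rw [map_add, LinearMap.add_apply, hx, hy, add_zero]
    · intro c x _ hx
      rw [smul_eq_mul, map_mul, Module.End.mul_apply, hx, map_zero]
  have h2 := LinearMap.congr_fun hkill 1
  rw [act_dd] at h2
  change a * (f 1 : D) - f (a * 1) = 0 at h2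
  rw [hf1] at h2
  apply hfa
  apply Subtype.ext
  simpa using h2

end bimod

end Ev

/-- Let `D` be a division ring which is a `K`-algebra with `D ⊗[K] Dᵐᵒᵖ`
Noetherian, and `A` a `K`-subalgebra of `D` such that every element of `D` is of the form
`s⁻¹ * a` with `a, s ∈ A`, `s ≠ 0` (so `D` is a left quotient division ring of `A`).
If `δ₁, …, δ_t` are pairwise commuting `K`-derivations of `A`, then the subgroup of
`(K^t, +)` generated by the monoid of common eigenvalues of the `δᵢ` in `A` is a finitely
generated abelian group. -/
theorem stmt11 (K D : Type*) [Field K] [DivisionRing D] [Algebra K D]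
    (hNoeth : IsNoetherianRing (D ⊗[K] Dᵐᵒᵖ))
    (A : Subalgebra K D)
    (hquot : ∀ d : D, ∃ a s : D, a ∈ A ∧ s ∈ A ∧ s ≠ 0 ∧ d = s⁻¹ * a)
    (t : ℕ) (δ : Fin t → (↥A →ₗ[K] ↥A))
    (hLeib : ∀ i, ∀ a b : ↥A, δ i (a * b) = δ i a * b + a * δ i b)
    (hcomm : ∀ i j, ∀ x : ↥A, δ i (δ j x) = δ j (δ i x)) :
    (AddSubgroup.closure
      {lam : Fin t → K | ∃ a : ↥A, a ≠ 0 ∧ ∀ i, δ i a = lam i • a}).FG := by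
  classical
  have hext := fun i => Ev.extend_der A hquot (δ i) (hLeib i)
  choose p hp hpA using hext
  set Lam := {lam : Fin t → K | ∃ a : ↥A, a ≠ 0 ∧ ∀ i, δ i a = lam i • a} with hLam
  have heig : ∀ lam ∈ Lam, ∃ x : D, x ≠ 0 ∧ Ev.IsEig p lam x := by
    rintro lam ⟨a, ha0, ha⟩
    refine ⟨a, fun h => ha0 (Subtype.ext h), fun i => ?_⟩
    rw [hpA, ha]; rfl
  choose! x hx0 hx using heig
  have hfg : (Submodule.span (D ⊗[K] Dᵐᵒᵖ) ((fun l => Ev.dd K D (x l)) '' Lam)).FG :=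
    IsNoetherian.noetherian _
  obtain ⟨s', hs', hspan⟩ := (Submodule.fg_span_iff_fg_span_finset_subset _).1 hfg
  obtain ⟨L, hL, rfl⟩ := Finset.subset_set_image_iff.1 hs'
  refine ⟨L, le_antisymm (AddSubgroup.closure_mono hL) ?_⟩
  rw [AddSubgroup.closure_le]
  intro lam hlam
  by_contra hnot
  set H := AddSubgroup.closure (L : Set (Fin t → K)) with hH
  refine Ev.dd_notMem K D (Ev.S hp H) ?_ (x '' L) ?_ (x lam)
    (Ev.notMem_S hp hnot (hx0 lam hlam) (hx lam hlam)) ?_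
  · intro k
    refine Ev.mem_S hp H.zero_mem ?_
    rw [Algebra.algebraMap_eq_smul_one]
    exact (Ev.isEig_one hp).smul k
  · rintro _ ⟨l, hl, rfl⟩
    exact Ev.mem_S hp (AddSubgroup.subset_closure hl) (hx l (hL hl))
  · have : Ev.dd K D (x lam) ∈
        Submodule.span (D ⊗[K] Dᵐᵒᵖ) ((fun l => Ev.dd K D (x l)) '' Lam) :=
      Submodule.subset_span ⟨lam, hlam, rfl⟩
    rw [hspan, Finset.coe_image] at this
    rwa [Set.image_image]
end

section
/- Let K be a field and L a field extension of K which is finitely generated as a field over K, and let δ₁, …, δ_t be pairwise commuting K-derivations of L. Let Ev(Δ) := { λ ∈ K^t : there exists u ∈ L, u ≠ 0, with δᵢ(u) = λᵢ·u for all i }, an additive subgroup of K^t. Then the rank of Ev(Δ), i.e., dim_ℚ(ℚ ⊗_ℤ Ev(Δ)), is at most the transcendence degree of L over K. -/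
universe u

open TensorProduct

/-- A product of powers of common eigenvectors is a common eigenvector. -/
theorem eigen_monomial {K L : Type*} [Field K] [Field L] [Algebra K L]
    (D : Derivation K L L) {ι : Type*} (v : ι → L) (c : ι → K)
    (h : ∀ i, D (v i) = c i • v i) (a : ι →₀ ℕ) :
    D (a.prod fun i k => v i ^ k) = (a.sum fun i k => k • c i) • (a.prod fun i k => v i ^ k) := by
  classical
  induction a using Finsupp.induction_linear with
  | zero => simp
  | add f g hf hg =>
    rw [Finsupp.prod_add_index' (by simp) (by intros; rw [pow_add]),
      Finsupp.sum_add_index' (by simp) (by intros; rw [add_smul]), D.leibniz, hf, hg]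
    simp only [smul_eq_mul]
    simp only [Algebra.smul_def, map_add]
    ring
  | single i k =>
    rw [Finsupp.prod_single_index (by simp), Finsupp.sum_single_index (by simp), D.leibniz_pow, h]
    rcases k with _ | k
    · simp
    · simp only [smul_eq_mul, nsmul_eq_mul, Nat.add_sub_cancel]
      simp only [Algebra.smul_def, map_mul, map_natCast, pow_succ]
      ring

/-- Let `L/K` be a finitely generated field extension and `δ₁, …, δ_t`
pairwise commuting `K`-derivations of `L`.  Then the rank `dim_ℚ (ℚ ⊗_ℤ Ev(Δ))` of the
additive group `Ev(Δ)` of common eigenvalues is at most the transcendence degree of `L`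
over `K` (the cardinality of any transcendence basis). -/
theorem stmt18 (K L : Type u) [Field K] [Field L] [Algebra K L]
    (hfg : ∃ S : Finset L, IntermediateField.adjoin K (S : Set L) = ⊤)
    (t : ℕ) (δ : Fin t → Derivation K L L)
    (hcomm : ∀ i j, ∀ x : L, δ i (δ j x) = δ j (δ i x))
    (G : AddSubgroup (Fin t → K))
    (hG : (G : Set (Fin t → K)) =
      {lam : Fin t → K | ∃ v : L, v ≠ 0 ∧ ∀ i, δ i v = lam i • v}) :
    ∀ s : Set L, IsTranscendenceBasis K ((↑) : s → L) →
      Module.rank ℚ (ℚ ⊗[ℤ] ↥G) ≤ Cardinal.mk s := by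
  intro s hs
  have h1 : Module.rank ℚ (ℚ ⊗[ℤ] ↥G) = Module.rank ℤ ↥G := by
    rw [← IsLocalizedModule.rank_eq (nonZeroDivisors ℤ) le_rfl (TensorProduct.mk ℤ ℚ G 1)]
    exact IsFractionRing.rank_right_eq (R := ℤ) (S := ℚ) (N := ℚ ⊗[ℤ] ↥G)
  rw [h1, hs.cardinalMk_eq_trdeg, Module.rank_def]
  apply ciSup_le'
  rintro ⟨B, hB⟩
  have hv : ∀ b : B, ∃ v : L, v ≠ 0 ∧ ∀ i, δ i v = (b : G).1 i • v := by
    intro b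
    have h : ((b : G) : Fin t → K) ∈ (G : Set (Fin t → K)) := (b : G).2
    rw [hG] at h
    exact h
  choose v hv0 hv using hv
  refine AlgebraicIndependent.cardinalMk_le_trdeg (R := K) (x := v) ?_
  -- the weight of a monomial
  let W : (B →₀ ℕ) → (Fin t → K) := fun a i => a.sum fun b k => k • (b : G).1 i
  let m : (B →₀ ℕ) → L := fun a => a.prod fun b k => v b ^ k
  have hm : ∀ a i, δ i (m a) = W a i • m a := fun a i =>
    eigen_monomial (δ i) v (fun b => (b : G).1 i) (fun b => hv b i) a
  have hm0 : ∀ a, m a ≠ 0 := fun a =>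
    Finset.prod_ne_zero_iff.mpr fun b _ => pow_ne_zero _ (hv0 b)
  have hW : Function.Injective W := by
    have hB' : LinearIndependent ℕ ((↑) : B → G) := hB.restrict_scalars' ℕ
    intro a a' h
    apply hB'
    apply Subtype.ext
    have key : ∀ a : B →₀ ℕ,
        ((Finsupp.linearCombination ℕ ((↑) : B → G) a : G) : Fin t → K) = W a := by
      intro a
      ext i
      simp [W, Finsupp.linearCombination_apply, Finsupp.sum]
    rw [key, key, h]
  have hind : iSupIndep fun χ : Fin t → K =>
      ⨅ i, Module.End.maxGenEigenspace ((δ i).toLinearMap : Module.End K L) (χ i) := by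
    apply Module.End.independent_iInf_maxGenEigenspace_of_forall_mapsTo
    intro i j φ
    apply Module.End.mapsTo_maxGenEigenspace_of_comm
    ext x
    exact hcomm j i x
  have hlin : LinearIndependent K m := by
    refine (hind.comp hW).linearIndependent _ (fun a => ?_) hm0
    simp only [Function.comp, Submodule.mem_iInf]
    intro i
    apply Module.End.mem_maxGenEigenspace _ _ _ |>.mpr
    refine ⟨1, ?_⟩
    simp [hm a i]
  rw [algebraicIndependent_iff]
  intro p hp
  rw [MvPolynomial.aeval_def, MvPolynomial.eval₂_eq] at hp
  have hz := linearIndependent_iff'.mp hlin p.support (fun d => p.coeff d) (by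
    rw [← hp]
    exact Finset.sum_congr rfl fun d _ => Algebra.smul_def _ _)
  ext d
  by_contra hd
  exact hd (by rw [hz d (MvPolynomial.mem_support_iff.mpr (by simpa using hd))]; simp)
end
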